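/- Let α ≥ 2. There exist a constant K_α > 0 depending only on α and an absolute constant c ≥ 1 such that for all K ≥ K_α and all integers s with c ≤ s ≤ p, there exists a constant c' > 0 depending only on α and K such that inf over all measurable tests φ of R_{P_{α,K}^⊗}(ρ,φ) is at least 1/2 whenever ρ² ≤ c'·[min(s·(p/s)^{2/α}, p^{max(2/α,1/2)}·(log log(8n))^{ω₂}) + log log(8n)], where ω₂ := 1/2 if s > √(p·log log(8n)) and α ≥ 4, and ω₂ := 0 otherwise. -/

import Mathlib

open MeasureTheory
open scoped Classical

namespace ChangePoint

noncomputable section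

/-- The `i`-th column (0-based) of the data matrix, with out-of-range guard. -/
def col (p n : ℕ) (X : Fin n → Fin p → ℝ) (i : ℕ) : Fin p → ℝ :=
  if h : i < n then X ⟨i, h⟩ else 0

/-- ℓ₀-"norm": the number of nonzero coordinates. -/
def l0 (p : ℕ) (v : Fin p → ℝ) : ℕ :=
  (Finset.univ.filter fun j : Fin p => v j ≠ 0).card

/-- Squared Euclidean norm on `ℝ^p`. -/
def sqnorm (p : ℕ) (v : Fin p → ℝ) : ℝ := ∑ j, v j ^ 2

/-- The iterated logarithm `log log (8 n)`. -/
def LL (n : ℕ) : ℝ := Real.log (Real.log (8 * n))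

/-- The sub-Weibull class `𝒢_{α,K}` of distributions on `ℝ`:
mean `0`, variance `1` and `𝔼 exp (|W/K|^α) ≤ 2`. -/
def memG (α K : ℝ) (ν : Measure ℝ) : Prop :=
  IsProbabilityMeasure ν ∧ Integrable id ν ∧ (∫ x, x ∂ν) = 0 ∧
    (∫⁻ x, ENNReal.ofReal (x ^ 2) ∂ν) = 1 ∧
    (∫⁻ x, ENNReal.ofReal (Real.exp (|x / K| ^ α)) ∂ν) ≤ 2

/-- The polynomially-tailed class `𝒫_{α,K}` of distributions on `ℝ`:
mean `0`, variance `1` and `𝔼 |W/K|^α ≤ 1`. -/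
def memP (α K : ℝ) (ν : Measure ℝ) : Prop :=
  IsProbabilityMeasure ν ∧ Integrable id ν ∧ (∫ x, x ∂ν) = 0 ∧
    (∫⁻ x, ENNReal.ofReal (x ^ 2) ∂ν) = 1 ∧
    (∫⁻ x, ENNReal.ofReal (|x / K| ^ α) ∂ν) ≤ 1

/-- `P` is the joint law on `ℝ^{p×n}` of `p·n` independent entries with marginal laws `ν t j`
(characterised on measurable rectangles). -/
def IsEntrywiseProduct (p n : ℕ) (P : Measure (Fin n → Fin p → ℝ))
    (ν : Fin n → Fin p → Measure ℝ) : Prop :=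
  IsProbabilityMeasure P ∧
    ∀ s : Fin n → Fin p → Set ℝ, (∀ t j, MeasurableSet (s t j)) →
      P {x | ∀ t j, x t j ∈ s t j} = ∏ t, ∏ j, ν t j (s t j)

/-- The class `𝒢_{α,K}^⊗` of noise distributions. -/
def Gclass (p n : ℕ) (α K : ℝ) : Set (Measure (Fin n → Fin p → ℝ)) :=
  {P | ∃ ν : Fin n → Fin p → Measure ℝ, (∀ t j, memG α K (ν t j)) ∧ IsEntrywiseProduct p n P ν}

/-- The class `𝒫_{α,K}^⊗` of noise distributions. -/
def Pclass (p n : ℕ) (α K : ℝ) : Set (Measure (Fin n → Fin p → ℝ)) :=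
  {P | ∃ ν : Fin n → Fin p → Measure ℝ, (∀ t j, memP α K (ν t j)) ∧ IsEntrywiseProduct p n P ν}

/-- The null parameter space `Θ₀(p,n)`: constant signal. -/
def Theta0 (p n : ℕ) : Set (Fin n → Fin p → ℝ) :=
  {θ | ∃ μ : Fin p → ℝ, ∀ t, θ t = μ}

/-- `Θ^{(t₀)}(p,n,s,ρ)`: a single mean change at (1-based) time `t0` of sparsity `s` and
normalized signal strength at least `ρ`. -/
def ThetaAt (p n t0 s : ℕ) (ρ : ℝ) : Set (Fin n → Fin p → ℝ) :=
  {θ | ∃ μ₁ μ₂ : Fin p → ℝ,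
    (∀ t : Fin n, (t : ℕ) < t0 → θ t = μ₁) ∧
    (∀ t : Fin n, t0 ≤ (t : ℕ) → θ t = μ₂) ∧
    l0 p (fun j => μ₁ j - μ₂ j) ≤ s ∧
    ρ ^ 2 ≤ (t0 : ℝ) * ((n : ℝ) - (t0 : ℝ)) / (n : ℝ) * sqnorm p (fun j => μ₁ j - μ₂ j)}

/-- The single-change-point alternative `Θ(p,n,s,ρ)`. -/
def Theta1 (p n s : ℕ) (ρ : ℝ) : Set (Fin n → Fin p → ℝ) :=
  ⋃ t0 ∈ Finset.Icc 1 (n - 1), ThetaAt p n t0 s ρ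

/-- A (randomized-free) test: a measurable `{0,1}`-valued function of the data. -/
def IsTest (p n : ℕ) (φ : (Fin n → Fin p → ℝ) → ℝ) : Prop :=
  Measurable φ ∧ ∀ x, φ x = 0 ∨ φ x = 1

/-- The worst-case testing error of the test `φ` for null `Θ₀(p,n)` against the
alternative `Θalt`, over the noise class `Q`. -/
def risk (p n : ℕ) (Q : Set (Measure (Fin n → Fin p → ℝ)))
    (Θalt : Set (Fin n → Fin p → ℝ)) (φ : (Fin n → Fin p → ℝ) → ℝ) : ℝ :=
  (⨆ P ∈ Q, ⨆ θ ∈ Theta0 p n, ∫ E, φ (θ + E) ∂P) +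
  (⨆ P ∈ Q, ⨆ θ ∈ Θalt, ∫ E, (1 - φ (θ + E)) ∂P)

/-- The dyadic grid `𝒯 = {1,2,4,…,2^{⌊log₂(n/2)⌋}}`. -/
def Tgrid (n : ℕ) : Finset ℕ :=
  (Finset.range (Nat.log 2 (n / 2) + 1)).image fun k => 2 ^ k

/-- The CUSUM-type statistic `Y_t`. -/
def Yt (p n : ℕ) (X : Fin n → Fin p → ℝ) (t : ℕ) (j : Fin p) : ℝ :=
  (∑ i ∈ Finset.range t, (col p n X i j - col p n X (n - 1 - i) j)) / Real.sqrt (2 * t)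

/-- `A_t = ∑_j (Y_t(j)² − 1)`. -/
def At (p n : ℕ) (X : Fin n → Fin p → ℝ) (t : ℕ) : ℝ :=
  ∑ j, (Yt p n X t j ^ 2 - 1)

/-- The dense sub-Weibull test `φ_{𝒢,dense}` with threshold `r`. -/
def phiGdense (p n : ℕ) (r : ℝ) (X : Fin n → Fin p → ℝ) : ℝ :=
  if ∃ t ∈ Tgrid n, r < At p n X t then 1 else 0

/-- Sample-splitting statistic `Y_{t,1}` (odd-indexed observations). -/
def Yt1 (p n : ℕ) (X : Fin n → Fin p → ℝ) (t : ℕ) (j : Fin p) : ℝ :=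
  (∑ i ∈ Finset.range (t / 2), (col p n X (2 * i) j - col p n X (n - 1 - 2 * i) j)) /
    Real.sqrt t

/-- Sample-splitting statistic `Y_{t,2}` (even-indexed observations). -/
def Yt2 (p n : ℕ) (X : Fin n → Fin p → ℝ) (t : ℕ) (j : Fin p) : ℝ :=
  (∑ i ∈ Finset.range (t / 2), (col p n X (2 * i + 1) j - col p n X (n - 2 - 2 * i) j)) /
    Real.sqrt t

/-- `Y_1 = (X_1 − X_n)/√2`. -/
def Y1 (p n : ℕ) (X : Fin n → Fin p → ℝ) (j : Fin p) : ℝ :=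
  (col p n X 0 j - col p n X (n - 1) j) / Real.sqrt 2

/-- The hard-thresholded statistic `A_{t,a}`. -/
def Ata (p n : ℕ) (X : Fin n → Fin p → ℝ) (t : ℕ) (a : ℝ) : ℝ :=
  if t = 1 then ∑ j, (Y1 p n X j ^ 2 - 1) * (if a ≤ |Y1 p n X j| then 1 else 0)
  else ∑ j, (Yt1 p n X t j ^ 2 - 1) * (if a ≤ |Yt2 p n X t j| then 1 else 0)

/-- The sparse sub-Weibull test `φ_{𝒢,sparse}` with threshold parameters `a, r, r₁`. -/
def phiGsparse (p n : ℕ) (a r r₁ : ℝ) (X : Fin n → Fin p → ℝ) : ℝ :=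
  if (∃ t ∈ Tgrid n, t ≠ 1 ∧ r < Ata p n X t a) ∨ r₁ < Ata p n X 1 a then 1 else 0

/-- The median of a list of reals: its `⌈m/2⌉`-th smallest element. -/
def median (l : List ℝ) : ℝ :=
  (l.insertionSort (· ≤ ·)).getD ((l.length + 1) / 2 - 1) 0

/-- `Z_i = (X_i − X_{n+1−i})/√2` (0-based index `i`). -/
def Zb (p n : ℕ) (X : Fin n → Fin p → ℝ) (i : ℕ) (j : Fin p) : ℝ :=
  (col p n X i j - col p n X (n - 1 - i) j) / Real.sqrt 2

/-- Mean of the `g`-th (0-based) of `G` consecutive equal-size groups of `Z_1,…,Z_t`. -/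
def groupMean (p n : ℕ) (X : Fin n → Fin p → ℝ) (t G g : ℕ) (j : Fin p) : ℝ :=
  (∑ i ∈ Finset.range (t / G), Zb p n X (g * (t / G) + i) j) / ((t / G : ℕ) : ℝ)

/-- The median-of-means statistic `A_t^{MoM}` with `G` groups. -/
def AMoM (p n : ℕ) (X : Fin n → Fin p → ℝ) (t G : ℕ) : ℝ :=
  (t : ℝ) * median (List.ofFn fun g : Fin G =>
    ∑ j, (groupMean p n X t G (g : ℕ) j ^ 2 - (G : ℝ) / (t : ℝ)))

/-- `Δ = 2^{3+⌈log₂ log log (8n)⌉}`. -/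
def DeltaDense (n : ℕ) : ℕ := 2 ^ (3 + (Int.ceil (Real.logb 2 (LL n))).toNat)

/-- The dense median-of-means test `φ_{𝒫,dense}`. -/
def phiPdense (p n : ℕ) (α C₁ : ℝ) (X : Fin n → Fin p → ℝ) : ℝ :=
  if ∃ t ∈ Tgrid n,
      1 < AMoM p n X t (min t (DeltaDense n)) /
        (C₁ * (p : ℝ) ^ max ((1 : ℝ) / 2) (2 / α) * ((min t (DeltaDense n) : ℕ) : ℝ))
  then 1 else 0

/-- `Δ = 2^{4+⌈log₂ log log (8n)⌉}`. -/
def DeltaSparse (n : ℕ) : ℕ := 2 ^ (4 + (Int.ceil (Real.logb 2 (LL n))).toNat)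

/-- Mean of the `g`-th (0-based) of `G` consecutive equal-size groups of the odd-indexed
`Z_1, Z_3, …, Z_{t−1}`. -/
def groupMeanOdd (p n : ℕ) (X : Fin n → Fin p → ℝ) (t G g : ℕ) (j : Fin p) : ℝ :=
  (∑ i ∈ Finset.range (t / (2 * G)), Zb p n X (2 * (g * (t / (2 * G)) + i)) j) /
    ((t / (2 * G) : ℕ) : ℝ)

/-- The hard-thresholded median-of-means statistic `A_{t,a}^{MoM}` with `G` groups. -/
def AMoMa (p n : ℕ) (X : Fin n → Fin p → ℝ) (t G : ℕ) (a : ℝ) : ℝ :=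
  if t = 1 then ∑ j, (Zb p n X 0 j ^ 2 - 1) * (if a ≤ |Zb p n X 0 j| then 1 else 0)
  else ((t : ℝ) / 2) * median (List.ofFn fun g : Fin G =>
    ∑ j, (groupMeanOdd p n X t G (g : ℕ) j ^ 2 - 2 * (G : ℝ) / (t : ℝ)) *
      (if a ≤ |Yt2 p n X t j| then 1 else 0))

/-- The sparse median-of-means test `φ_{𝒫,sparse}^{MoM}`. -/
def phiPsparseMoM (p n s : ℕ) (α C₁ C₂ : ℝ) (X : Fin n → Fin p → ℝ) : ℝ :=
  if ∃ t ∈ Tgrid n,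
      1 < AMoMa p n X t (min t (DeltaSparse n) / 2)
            (C₁ * (((p : ℝ) / (s : ℝ)) ^ ((1 : ℝ) / α) +
              ((s : ℝ) ^ (-(1 : ℝ) / 2)) * Real.sqrt (LL n))) /
          (C₂ * (if t = 1 then (s : ℝ) * ((p : ℝ) / (s : ℝ)) ^ ((2 : ℝ) / α)
                 else Real.sqrt (s : ℝ) * ((min t (DeltaSparse n) / 2 : ℕ) : ℝ)))
  then 1 else 0

/-- Condition RSM for `(α, K)` with constants `C₁, C₂`: statistical guarantee for a family
of (measurable) robust sparse mean estimators. -/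
def CondRSM (p s : ℕ) (α K C₁ C₂ : ℝ)
    (est : (m : ℕ) → (Fin m → Fin p → ℝ) → ℝ → Fin p → ℝ) : Prop :=
  (∀ m : ℕ, Measurable fun Wη : (Fin m → Fin p → ℝ) × ℝ => est m Wη.1 Wη.2) ∧
  ∀ (m : ℕ) (μW : Fin p → ℝ) (ν : Fin m → Measure (Fin p → ℝ))
    (P : Measure (Fin m → Fin p → ℝ)) (η : ℝ),
    0 < η → η < 1 → l0 p μW ≤ s →
    (∀ i, IsProbabilityMeasure (ν i)) →
    (∀ i j, Integrable (fun w => w j) (ν i) ∧ (∫ w, w j ∂ν i) = μW j) →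
    (∀ i j k, Integrable (fun w => (w j - μW j) * (w k - μW k)) (ν i) ∧
      (∫ w, (w j - μW j) * (w k - μW k) ∂ν i) = if j = k then 1 else 0) →
    (∀ i j, (∫⁻ w, ENNReal.ofReal (|w j - μW j| ^ α) ∂ν i) ≤
      ENNReal.ofReal ((Real.sqrt 2 * K) ^ α)) →
    IsProbabilityMeasure P →
    (∀ S : Fin m → Set (Fin p → ℝ), (∀ i, MeasurableSet (S i)) →
      P {W | ∀ i, W i ∈ S i} = ∏ i, ν i (S i)) →
    C₁ * ((s : ℝ) * Real.log (Real.exp 1 * (p : ℝ) / (s : ℝ)) + Real.log (1 / η)) ≤ (m : ℝ) →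
    ENNReal.ofReal (1 - η) ≤
      P {W | Real.sqrt (sqnorm p fun j => est m W η j - μW j) ≤
        Real.sqrt C₂ * (Real.sqrt ((s : ℝ) * Real.log (Real.exp 1 * (p : ℝ) / (s : ℝ)) / (m : ℝ)) +
          Real.sqrt (Real.log (1 / η) / (m : ℝ)))}

/-- `Δ̃₁ = C₅ (s log(ep/s) + log(16/ε))`. -/
def rsmDelta1 (p s : ℕ) (ε C₅ : ℝ) : ℝ :=
  C₅ * ((s : ℝ) * Real.log (Real.exp 1 * (p : ℝ) / (s : ℝ)) + Real.log (16 / ε))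

/-- `Δ̃₂ = C₅ (s log(ep/s) + log(16 log(2n)/ε))`. -/
def rsmDelta2 (p s n : ℕ) (ε C₅ : ℝ) : ℝ :=
  C₅ * ((s : ℝ) * Real.log (Real.exp 1 * (p : ℝ) / (s : ℝ)) +
    Real.log (16 * Real.log (2 * (n : ℝ)) / ε))

/-- `a = C₃ ((p/s)^{1/α} + s^{−1/2} log^{1/2}(log Δ̃₁))`. -/
def rsmA (p s : ℕ) (α ε C₃ C₅ : ℝ) : ℝ :=
  C₃ * (((p : ℝ) / (s : ℝ)) ^ ((1 : ℝ) / α) +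
    ((s : ℝ) ^ (-(1 : ℝ) / 2)) * Real.sqrt (Real.log (Real.log (rsmDelta1 p s ε C₅))))

/-- The sparse test `φ^{RSM}_{𝒫,sparse}` built from a robust sparse mean estimator `est`. -/
def phiRSM (p n s : ℕ) (est : (m : ℕ) → (Fin m → Fin p → ℝ) → ℝ → Fin p → ℝ)
    (α ε C₃ C₄ C₅ C₆ : ℝ) (X : Fin n → Fin p → ℝ) : ℝ :=
  if (∃ t ∈ Tgrid n, (t : ℝ) ≤ rsmDelta1 p s ε C₅ ∧
        1 < Ata p n X t (rsmA p s α ε C₃ C₅) /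
          (C₄ * (if t = 1 then (s : ℝ) * ((p : ℝ) / (s : ℝ)) ^ ((2 : ℝ) / α)
                 else Real.sqrt ((s : ℝ) * Real.log (rsmDelta1 p s ε C₅))))) ∨
     (∃ t ∈ Tgrid n, rsmDelta1 p s ε C₅ < (t : ℝ) ∧
        1 < (t : ℝ) * sqnorm p (est t (fun i : Fin t => fun j => Zb p n X (i : ℕ) j)
              (Real.exp ((s : ℝ) * Real.log (Real.exp 1 * (p : ℝ) / (s : ℝ)) -
                min (t : ℝ) (rsmDelta2 p s n ε C₅) / C₅))) /
          (C₆ * min (t : ℝ) (rsmDelta2 p s n ε C₅)))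
  then 1 else 0

/-- The multiple-change-point alternative `Θ_multi(p,n,ρ)`. -/
def ThetaMulti (p n : ℕ) (ρ : ℝ) : Set (Fin n → Fin p → ℝ) :=
  {θ | ∃ k : ℕ, 1 ≤ k ∧ ∃ τ : ℕ → ℕ, ∃ μ : ℕ → Fin p → ℝ,
    τ 0 = 0 ∧ τ (k + 1) = n ∧ (∀ i ≤ k, τ i < τ (i + 1)) ∧
    (∀ i, 1 ≤ i → i ≤ k + 1 →
      ∀ t : Fin n, τ (i - 1) ≤ (t : ℕ) → (t : ℕ) < τ i → θ t = μ i) ∧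
    ∃ i, 1 ≤ i ∧ i ≤ k ∧
      4 * Real.log (n : ℝ) ≤ ((min (τ i - τ (i - 1)) (τ (i + 1) - τ i) : ℕ) : ℝ) ∧
      ρ ^ 2 ≤ sqnorm p (fun j => μ (i + 1) j - μ i j) *
        ((min (τ i - τ (i - 1)) (τ (i + 1) - τ i) : ℕ) : ℝ)}

/-- Membership in the temporal-dependence class `𝒫_Temp`: independent rows, entrywise
`𝒫_{α,K}` marginals, and exponentially decaying interlaced α-mixing coefficients. -/
def memPTemp (p n : ℕ) (α K c₁ c₂ : ℝ) (P : Measure (Fin n → Fin p → ℝ)) : Prop :=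
  IsProbabilityMeasure P ∧
  (∀ s : Fin p → Set (Fin n → ℝ), (∀ j, MeasurableSet (s j)) →
    P {x | ∀ j, (fun t => x t j) ∈ s j} = ∏ j, P {x | (fun t => x t j) ∈ s j}) ∧
  (∀ t j, memP α K (P.map fun x => x t j)) ∧
  (∀ i : ℕ, 1 ≤ i → i ≤ n - 1 →
    ∀ S T : Set (Fin n),
      (∀ s' ∈ S, ∀ t' ∈ T, (i : ℤ) ≤ |((s' : ℕ) : ℤ) - ((t' : ℕ) : ℤ)|) →
      ∀ A B : Set (Fin n → Fin p → ℝ),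
        MeasurableSet[MeasurableSpace.comap (fun x (t : S) => x t.1) inferInstance] A →
        MeasurableSet[MeasurableSpace.comap (fun x (t : T) => x t.1) inferInstance] B →
        |(P (A ∩ B)).toReal - (P A).toReal * (P B).toReal| ≤ c₁ * Real.exp (-c₂ * (i : ℝ)))

/-- The class `𝒲_α` of distributions on `ℝ^p`: centered with `𝔼|⟨W,v⟩|^α ≤ 1` for
every unit vector `v`. -/
def memW (p : ℕ) (α : ℝ) (ν : Measure (Fin p → ℝ)) : Prop :=
  IsProbabilityMeasure ν ∧
  (∀ j, Integrable (fun w => w j) ν ∧ (∫ w, w j ∂ν) = 0) ∧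
  ∀ v : Fin p → ℝ, sqnorm p v = 1 →
    (∫⁻ w, ENNReal.ofReal (|∑ j, w j * v j| ^ α) ∂ν) ≤ 1

/-- The class `𝒲_α^⊗`: independent columns with distributions in `𝒲_α`. -/
def Wclass (p n : ℕ) (α : ℝ) : Set (Measure (Fin n → Fin p → ℝ)) :=
  {P | ∃ ν : Fin n → Measure (Fin p → ℝ), (∀ t, memW p α (ν t)) ∧
    IsProbabilityMeasure P ∧
    ∀ s : Fin n → Set (Fin p → ℝ), (∀ t, MeasurableSet (s t)) →
      P {x | ∀ t, x t ∈ s t} = ∏ t, ν t (s t)}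

/-- The alternative `⋃_{t₀=1}^{n−1} Θ(p,n,ρ_{t₀})` for a location-dependent signal
strength sequence `ρ`. -/
def ThetaSeq (p n : ℕ) (ρ : ℕ → ℝ) : Set (Fin n → Fin p → ℝ) :=
  ⋃ t0 ∈ Finset.Icc 1 (n - 1),
    {θ | ∃ μ₁ μ₂ : Fin p → ℝ,
      (∀ t : Fin n, (t : ℕ) < t0 → θ t = μ₁) ∧
      (∀ t : Fin n, t0 ≤ (t : ℕ) → θ t = μ₂) ∧
      (ρ t0) ^ 2 ≤ sqnorm p (fun j => μ₁ j - μ₂ j)}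

/-- The boundary-restricted alternative `Θ_res(p,n,s,ρ)`. -/
def ThetaRes (p n s : ℕ) (ρ tres : ℝ) : Set (Fin n → Fin p → ℝ) :=
  {θ | ∃ t0 : ℕ, tres + 1 ≤ (t0 : ℝ) ∧ (t0 : ℝ) ≤ (n : ℝ) - tres ∧ θ ∈ ThetaAt p n t0 s ρ}

/-- `t^res = 32 (log (e² p / s) + s^{−1} log log (8n))`. -/
def tRes (p n s : ℕ) : ℝ :=
  32 * (Real.log (Real.exp 1 ^ 2 * (p : ℝ) / (s : ℝ)) + LL n / (s : ℝ))

end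

open ProbabilityTheory

lemma le_biSup_of_le_one {β : Type*} (S : Set β) (F : β → ℝ)
    (h1 : ∀ x ∈ S, F x ≤ 1) {x : β} (hx : x ∈ S) : F x ≤ ⨆ y ∈ S, F y := by
  have hb : BddAbove (Set.range fun y => ⨆ (_ : y ∈ S), F y) := by
    refine ⟨1, ?_⟩
    rintro _ ⟨y, rfl⟩
    exact Real.iSup_le (fun hy => h1 y hy) zero_le_one
  have := le_ciSup hb x
  simpa [ciSup_pos hx] using this

lemma biSup_mem_unit {β : Type*} (S : Set β) (F : β → ℝ) (h0 : ∀ x ∈ S, 0 ≤ F x)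
    (h1 : ∀ x ∈ S, F x ≤ 1) : 0 ≤ (⨆ y ∈ S, F y) ∧ (⨆ y ∈ S, F y) ≤ 1 :=
  ⟨Real.iSup_nonneg fun y => Real.iSup_nonneg fun hy => h0 y hy,
    Real.iSup_le (fun y => Real.iSup_le (fun hy => h1 y hy) zero_le_one) zero_le_one⟩

lemma integral_mem_unit {Ω : Type*} [MeasurableSpace Ω] (P : Measure Ω) [IsProbabilityMeasure P]
    (f : Ω → ℝ) (h0 : ∀ x, 0 ≤ f x) (h1 : ∀ x, f x ≤ 1) : 0 ≤ ∫ x, f x ∂P ∧ ∫ x, f x ∂P ≤ 1 := by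
  refine ⟨integral_nonneg h0, ?_⟩
  by_cases hf : Integrable f P
  · calc ∫ x, f x ∂P ≤ ∫ _, (1 : ℝ) ∂P := integral_mono hf (integrable_const _) h1
      _ = 1 := by simp
  · rw [integral_undef hf]; exact zero_le_one

/-- The risk dominates the Bayes risk for a point null and a sub-probability prior. -/
lemma bayes_le_risk {p n : ℕ} {Q : Set (Measure (Fin n → Fin p → ℝ))}
    (hQ : ∀ P ∈ Q, IsProbabilityMeasure P) {Θalt : Set (Fin n → Fin p → ℝ)}
    {φ : (Fin n → Fin p → ℝ) → ℝ} (hφ : IsTest p n φ) {ι : Type*} (G : Finset ι) (w : ι → ℝ)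
    (hw : ∀ i ∈ G, 0 ≤ w i) (hw1 : ∑ i ∈ G, w i ≤ 1)
    {P₀ : Measure (Fin n → Fin p → ℝ)} (hP₀ : P₀ ∈ Q) {θ₀ : Fin n → Fin p → ℝ}
    (hθ₀ : θ₀ ∈ Theta0 p n) (P : ι → Measure (Fin n → Fin p → ℝ)) (θ : ι → Fin n → Fin p → ℝ)
    (hP : ∀ i ∈ G, P i ∈ Q) (hθ : ∀ i ∈ G, θ i ∈ Θalt) :
    (∫ E, φ (θ₀ + E) ∂P₀) + ∑ i ∈ G, w i * ∫ E, (1 - φ (θ i + E)) ∂(P i) ≤ risk p n Q Θalt φ := by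
  have hφ0 : ∀ x, 0 ≤ φ x := fun x => by rcases hφ.2 x with h | h <;> simp [h]
  have hφ1 : ∀ x, φ x ≤ 1 := fun x => by rcases hφ.2 x with h | h <;> simp [h]
  have key : ∀ (ψ : (Fin n → Fin p → ℝ) → ℝ) (Θ : Set (Fin n → Fin p → ℝ)), (∀ x, 0 ≤ ψ x) →
      (∀ x, ψ x ≤ 1) → (0 ≤ (⨆ P ∈ Q, ⨆ θ ∈ Θ, ∫ E, ψ (θ + E) ∂P)) ∧
      ∀ P ∈ Q, ∀ θ ∈ Θ, (∫ E, ψ (θ + E) ∂P) ≤ ⨆ P ∈ Q, ⨆ θ ∈ Θ, ∫ E, ψ (θ + E) ∂P := by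
    intro ψ Θ h0 h1
    have hin : ∀ P ∈ Q, ∀ θ ∈ Θ, 0 ≤ ∫ E, ψ (θ + E) ∂P ∧ ∫ E, ψ (θ + E) ∂P ≤ 1 := by
      intro P hP θ _
      have := hQ P hP
      exact integral_mem_unit P _ (fun x => h0 _) (fun x => h1 _)
    have hout : ∀ P ∈ Q, 0 ≤ (⨆ θ ∈ Θ, ∫ E, ψ (θ + E) ∂P) ∧
        (⨆ θ ∈ Θ, ∫ E, ψ (θ + E) ∂P) ≤ 1 := fun P hP =>
      biSup_mem_unit Θ _ (fun θ hθ => (hin P hP θ hθ).1) (fun θ hθ => (hin P hP θ hθ).2)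
    refine ⟨(biSup_mem_unit Q _ (fun P hP => (hout P hP).1) (fun P hP => (hout P hP).2)).1, ?_⟩
    intro P hP θ hθ
    refine le_trans ?_ (le_biSup_of_le_one Q (fun P => ⨆ θ ∈ Θ, ∫ E, ψ (θ + E) ∂P)
      (fun P hP => (hout P hP).2) hP)
    exact le_biSup_of_le_one Θ (fun θ => ∫ E, ψ (θ + E) ∂P)
      (fun θ hθ => (hin P hP θ hθ).2) hθ
  have k1 := (key φ (Theta0 p n) hφ0 hφ1).2 P₀ hP₀ θ₀ hθ₀
  obtain ⟨k2, k3⟩ := key (fun x => 1 - φ x) Θalt (fun x => by linarith [hφ1 x])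
    (fun x => by linarith [hφ0 x])
  unfold risk
  refine add_le_add k1 ?_
  calc ∑ i ∈ G, w i * ∫ E, (1 - φ (θ i + E)) ∂(P i)
      ≤ ∑ i ∈ G, w i * ⨆ P ∈ Q, ⨆ θ ∈ Θalt, ∫ E, (1 - φ (θ + E)) ∂P :=
        Finset.sum_le_sum fun i hi =>
          mul_le_mul_of_nonneg_left (k3 _ (hP i hi) _ (hθ i hi)) (hw i hi)
    _ = (∑ i ∈ G, w i) * ⨆ P ∈ Q, ⨆ θ ∈ Θalt, ∫ E, (1 - φ (θ + E)) ∂P := by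
        rw [Finset.sum_mul]
    _ ≤ _ := mul_le_of_le_one_left k2 hw1

/-- Second moment method for the sum of the two errors of a test. -/
lemma second_moment_le_errors {Ω : Type*} [MeasurableSpace Ω] (μ : Measure Ω)
    [IsProbabilityMeasure μ] {ψ L : Ω → ℝ} (hψ : Measurable ψ) (hψ01 : ∀ x, ψ x = 0 ∨ ψ x = 1)
    (hL : Integrable L μ) (hL2 : Integrable (fun x => L x ^ 2) μ) (hL1 : ∫ x, L x ∂μ = 1) :
    3 / 4 - ((∫ x, L x ^ 2 ∂μ) - 1) ≤ (∫ x, ψ x ∂μ) + ∫ x, (1 - ψ x) * L x ∂μ := by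
  have hbd : ∀ x, ‖ψ x‖ ≤ 1 := fun x => by rcases hψ01 x with h | h <;> simp [h]
  have hbd' : ∀ x, ‖1 - ψ x‖ ≤ 1 := fun x => by rcases hψ01 x with h | h <;> simp [h]
  have i1 : Integrable ψ μ :=
    Integrable.of_bound hψ.aestronglyMeasurable 1 (Filter.Eventually.of_forall hbd)
  have i2 : Integrable (fun x => (1 - ψ x) * L x) μ :=
    hL.bdd_mul (c := 1) (measurable_const.sub hψ).aestronglyMeasurable
      (Filter.Eventually.of_forall hbd')
  rw [← integral_add i1 i2]
  have i3 : Integrable (fun x => 3 / 4 - (L x ^ 2 - 2 * L x + 1)) μ :=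
    (integrable_const _).sub ((hL2.sub (hL.const_mul 2)).add (integrable_const _))
  have e : 3 / 4 - ((∫ x, L x ^ 2 ∂μ) - 1) = ∫ x, (3 / 4 - (L x ^ 2 - 2 * L x + 1)) ∂μ := by
    have hb : Integrable (fun x => L x ^ 2 - 2 * L x) μ := hL2.sub (hL.const_mul 2)
    have hc : Integrable (fun x => L x ^ 2 - 2 * L x + 1) μ := hb.add (integrable_const _)
    rw [integral_sub (integrable_const _) hc, integral_add hb (integrable_const _),
      integral_sub hL2 (hL.const_mul 2), integral_const_mul, hL1]
    simp
    ring
  rw [e]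
  refine integral_mono i3 (i1.add i2) fun x => ?_
  rcases hψ01 x with h | h <;> simp only [h] <;> nlinarith [sq_nonneg (L x - 1 - 1/2),
    sq_nonneg (L x - 1 + 1/2)]

lemma pi_withDensity {κ Y : Type*} [Fintype κ] [MeasurableSpace Y] (lam : Measure Y)
    [IsProbabilityMeasure lam] (f : κ → Y → ENNReal) (hf : ∀ a, Measurable (f a))
    [∀ a, IsProbabilityMeasure (lam.withDensity (f a))] :
    Measure.pi (fun a => lam.withDensity (f a)) =
      (Measure.pi fun _ : κ => lam).withDensity (fun u => ∏ a, f a (u a)) := by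
  refine Measure.pi_eq fun s hs => ?_
  rw [withDensity_apply _ (MeasurableSet.univ_pi hs), ← lintegral_indicator (MeasurableSet.univ_pi hs)]
  have : ∀ u : κ → Y, (Set.univ.pi s).indicator (fun u => ∏ a, f a (u a)) u =
      ∏ a, (s a).indicator (f a) (u a) := by
    intro u
    by_cases hu : u ∈ Set.univ.pi s
    · rw [Set.indicator_of_mem hu]
      exact Finset.prod_congr rfl fun a _ => by rw [Set.indicator_of_mem (hu a trivial)]
    · rw [Set.indicator_of_notMem hu]
      simp only [Set.mem_pi, Set.mem_univ, true_implies, not_forall] at hu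
      obtain ⟨a, ha⟩ := hu
      exact (Finset.prod_eq_zero (Finset.mem_univ a) (Set.indicator_of_notMem ha _)).symm
  simp_rw [this]
  have hm : ∀ a, Measurable ((s a).indicator (f a)) := fun a => (hf a).indicator (hs a)
  rw [lintegral_prod_eq_prod_lintegral_of_indepFun Finset.univ
    (fun a (u : κ → Y) => (s a).indicator (f a) (u a))
    (iIndepFun_pi (μ := fun _ : κ => lam) fun a => (hm a).aemeasurable)
    (fun a => (hm a).comp (measurable_pi_apply a))]
  refine Finset.prod_congr rfl fun a _ => ?_
  rw [(measurePreserving_eval (fun _ : κ => lam) a).lintegral_comp (hm a),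
    lintegral_indicator (hs a), withDensity_apply _ (hs a)]

lemma isEntrywiseProduct_map {p n : ℕ} {Y : Type*} [MeasurableSpace Y]
    (ν : Fin n × Fin p → Measure Y) [∀ a, IsProbabilityMeasure (ν a)]
    (T : Fin n → Fin p → Y → ℝ) (hT : ∀ t j, Measurable (T t j)) :
    IsEntrywiseProduct p n
      ((Measure.pi ν).map fun u t j => T t j (u (t, j)))
      (fun t j => (ν (t, j)).map (T t j)) := by
  have hm : Measurable (fun (u : Fin n × Fin p → Y) t j => T t j (u (t, j))) :=
    measurable_pi_lambda _ fun t => measurable_pi_lambda _ fun j =>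
      (hT t j).comp (measurable_pi_apply _)
  refine ⟨Measure.isProbabilityMeasure_map hm.aemeasurable, fun s hs => ?_⟩
  have hset : MeasurableSet {x : Fin n → Fin p → ℝ | ∀ t j, x t j ∈ s t j} := by
    simp only [Set.ofPred_forall]
    exact MeasurableSet.iInter fun t => MeasurableSet.iInter fun j =>
      (hs t j).preimage ((measurable_pi_apply j).comp (measurable_pi_apply t))
  rw [Measure.map_apply hm hset]
  have : (fun (u : Fin n × Fin p → Y) t j => T t j (u (t, j))) ⁻¹'
      {x | ∀ t j, x t j ∈ s t j} = Set.univ.pi fun a => T a.1 a.2 ⁻¹' s a.1 a.2 := by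
    ext u; simp
  rw [this, Measure.pi_pi, Fintype.prod_prod_type]
  exact Finset.prod_congr rfl fun t _ => Finset.prod_congr rfl fun j _ =>
    (Measure.map_apply (hT t j) (hs t j)).symm

/-- Lower bound on the risk from a finite prior on signals and entrywise noise densities, with the
data generated coordinatewise from latent variables of law `lam`. -/
theorem half_le_risk_of_second_moment {p n : ℕ} {α K : ℝ} {Θalt : Set (Fin n → Fin p → ℝ)}
    {φ : (Fin n → Fin p → ℝ) → ℝ} (hφ : IsTest p n φ)
    {Y : Type*} [MeasurableSpace Y] (lam : Measure Y) [IsProbabilityMeasure lam]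
    (T : Y → ℝ) (hT : Measurable T) (hnull : memP α K (lam.map T))
    {ι : Type*} [Fintype ι] (w : ι → ℝ) (hw : ∀ i, 0 ≤ w i) (hw1 : ∑ i, w i = 1)
    (θ : ι → Fin n → Fin p → ℝ) (g : ι → Fin n → Fin p → Y → ℝ)
    (hgm : ∀ i t j, Measurable (g i t j)) (hg0 : ∀ i t j y, 0 ≤ g i t j y)
    (hgi : ∀ i t j, Integrable (g i t j) lam) (hg1 : ∀ i t j, ∫ y, g i t j y ∂lam = 1)
    (hgg : ∀ i i' t j, Integrable (fun y => g i t j y * g i' t j y) lam)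
    (hsecond : ∑ i, ∑ i', w i * w i' * ∏ t, ∏ j, ∫ y, g i t j y * g i' t j y ∂lam ≤ 9 / 8)
    (G : Finset ι) (hG : ∑ i ∈ Gᶜ, w i ≤ 1 / 8) (hθ : ∀ i ∈ G, θ i ∈ Θalt)
    (halt : ∀ i ∈ G, ∀ t j, memP α K
      ((lam.withDensity fun y => ENNReal.ofReal (g i t j y)).map fun y => T y - θ i t j)) :
    1 / 2 ≤ risk p n (Pclass p n α K) Θalt φ := by
  have hprob : ∀ i t j,
      IsProbabilityMeasure (lam.withDensity fun y => ENNReal.ofReal (g i t j y)) := by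
    intro i t j
    refine ⟨?_⟩
    rw [withDensity_apply _ MeasurableSet.univ, Measure.restrict_univ,
      ← ofReal_integral_eq_lintegral_ofReal (hgi i t j) (Filter.Eventually.of_forall (hg0 i t j)),
      hg1, ENNReal.ofReal_one]
  set μ : Measure (Fin n × Fin p → Y) := Measure.pi fun _ => lam with hμ
  set X : (Fin n × Fin p → Y) → Fin n → Fin p → ℝ := fun u t j => T (u (t, j)) with hX
  have hXm : Measurable X := measurable_pi_lambda _ fun t => measurable_pi_lambda _ fun j =>
      hT.comp (measurable_pi_apply _)
  set ν : ι → Measure (Fin n × Fin p → Y) := fun i => Measure.pi fun a : Fin n × Fin p =>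
    lam.withDensity fun y => ENNReal.ofReal (g i a.1 a.2 y) with hν
  set ell : ι → (Fin n × Fin p → Y) → ℝ := fun i u => ∏ a, g i a.1 a.2 (u a) with hell
  have hellm : ∀ i, Measurable (ell i) := fun i =>
    Finset.measurable_prod _ fun a _ => (hgm i a.1 a.2).comp (measurable_pi_apply a)
  have hell0 : ∀ i u, 0 ≤ ell i u := fun i u => Finset.prod_nonneg fun a _ => hg0 _ _ _ _
  have hνd : ∀ i, ν i = μ.withDensity fun u => ENNReal.ofReal (ell i u) := by
    intro i
    have : ∀ a : Fin n × Fin p, IsProbabilityMeasure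
      (lam.withDensity fun y => ENNReal.ofReal (g i a.1 a.2 y)) := fun a => hprob _ _ _
    simp only [hν, hell, hμ]
    rw [pi_withDensity lam (fun (a : Fin n × Fin p) y => ENNReal.ofReal (g i a.1 a.2 y))
      (fun a => (hgm i a.1 a.2).ennreal_ofReal)]
    congr 1
    funext u
    rw [ENNReal.ofReal_prod_of_nonneg fun a _ => hg0 _ _ _ _]
  have helli : ∀ i, Integrable (ell i) μ := fun i =>
    Integrable.fintype_prod (f := fun a : Fin n × Fin p => g i a.1 a.2) fun a => hgi i a.1 a.2
  have hell1 : ∀ i, ∫ u, ell i u ∂μ = 1 := fun i => by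
    simp only [hell, hμ]
    rw [integral_fintype_prod_eq_prod (fun (a : Fin n × Fin p) y => g i a.1 a.2 y)]
    exact Finset.prod_eq_one fun a _ => hg1 _ _ _
  have hellelli : ∀ i i', Integrable (fun u => ell i u * ell i' u) μ := fun i i' => by
    simp only [hell, ← Finset.prod_mul_distrib]
    exact Integrable.fintype_prod
      (f := fun (a : Fin n × Fin p) y => g i a.1 a.2 y * g i' a.1 a.2 y) fun a => hgg i i' a.1 a.2
  have hellell : ∀ i i', ∫ u, ell i u * ell i' u ∂μ =
      ∏ t, ∏ j, ∫ y, g i t j y * g i' t j y ∂lam := fun i i' => by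
    simp only [hell, ← Finset.prod_mul_distrib, hμ]
    rw [integral_fintype_prod_eq_prod
      (fun (a : Fin n × Fin p) y => g i a.1 a.2 y * g i' a.1 a.2 y), Fintype.prod_prod_type]
  set P : ι → Measure (Fin n → Fin p → ℝ) := fun i =>
    (ν i).map fun u t j => T (u (t, j)) - θ i t j with hP
  have hbayes := bayes_le_risk (Q := Pclass p n α K) (Θalt := Θalt)
    (fun P hP => hP.choose_spec.2.1) hφ G w (fun i _ => hw i)
    (by rw [← hw1]; exact Finset.sum_le_univ_sum_of_nonneg hw)
    (P₀ := μ.map X)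
    ⟨_, fun _ _ => hnull, isEntrywiseProduct_map (fun _ => lam) (fun _ _ => T) fun _ _ => hT⟩
    (θ₀ := 0) ⟨0, fun _ => rfl⟩ P θ
    (fun i hi => by
      have : ∀ a : Fin n × Fin p, IsProbabilityMeasure
        (lam.withDensity fun y => ENNReal.ofReal (g i a.1 a.2 y)) := fun a => hprob _ _ _
      exact ⟨_, fun t j => halt i hi t j, isEntrywiseProduct_map
        (fun a : Fin n × Fin p => lam.withDensity fun y => ENNReal.ofReal (g i a.1 a.2 y))
        (fun t j y => T y - θ i t j) fun t j => hT.sub measurable_const⟩) hθ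
  refine le_trans ?_ hbayes
  have hφX : Measurable fun u => φ (X u) := hφ.1.comp hXm
  have e0 : ∫ E, φ (0 + E) ∂(μ.map X) = ∫ u, φ (X u) ∂μ := by
    simp only [zero_add]
    exact integral_map hXm.aemeasurable hφ.1.aestronglyMeasurable
  have ei : ∀ i, ∫ E, (1 - φ (θ i + E)) ∂(P i) = ∫ u, (1 - φ (X u)) * ell i u ∂μ := by
    intro i
    have hm : Measurable (fun (u : Fin n × Fin p → Y) t j => T (u (t, j)) - θ i t j) :=
      measurable_pi_lambda _ fun t => measurable_pi_lambda _ fun j =>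
        (hT.comp (measurable_pi_apply _)).sub measurable_const
    have hmφ : Measurable fun E => 1 - φ (θ i + E) :=
      measurable_const.sub (hφ.1.comp (measurable_const_add (θ i)))
    simp only [hP]
    rw [integral_map hm.aemeasurable hmφ.aestronglyMeasurable,
      hνd i, integral_withDensity_eq_integral_toReal_smul (hellm i).ennreal_ofReal
        (Filter.Eventually.of_forall fun _ => ENNReal.ofReal_lt_top)]
    refine integral_congr_ae (Filter.Eventually.of_forall fun u => ?_)
    have : (θ i + fun t j => T (u (t, j)) - θ i t j) = X u := by
      funext t j; simp [hX]
    simp only [this, ENNReal.toReal_ofReal (hell0 i u), smul_eq_mul, mul_comm]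
  rw [e0, Finset.sum_congr rfl fun i _ => by rw [ei i]]
  have hψ01 : ∀ u, φ (X u) = 0 ∨ φ (X u) = 1 := fun u => hφ.2 _
  have hLi : Integrable (fun u => ∑ i, w i * ell i u) μ :=
    integrable_finsetSum _ fun i _ => (helli i).const_mul _
  have hLsq : (fun u => (∑ i, w i * ell i u) ^ 2) =
      fun u => ∑ i, ∑ i', w i * w i' * (ell i u * ell i' u) := by
    funext u
    rw [sq, Finset.sum_mul_sum]
    exact Finset.sum_congr rfl fun i _ => Finset.sum_congr rfl fun i' _ => by ring
  have hsm := second_moment_le_errors μ hφX hψ01 hLi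
    (by
      rw [hLsq]
      exact integrable_finsetSum _ fun i _ => integrable_finsetSum _ fun i' _ =>
        (hellelli i i').const_mul _)
    (by
      rw [integral_finsetSum _ fun i _ => (helli i).const_mul _]
      simp only [integral_const_mul, hell1, mul_one, hw1])
  have hsq : ∫ u, (∑ i, w i * ell i u) ^ 2 ∂μ ≤ 9 / 8 := by
    rw [hLsq, integral_finsetSum _ fun i _ => integrable_finsetSum _ fun i' _ =>
        (hellelli i i').const_mul _]
    refine le_trans (le_of_eq ?_) hsecond
    refine Finset.sum_congr rfl fun i _ => ?_
    rw [integral_finsetSum _ fun i' _ => (hellelli i i').const_mul _]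
    exact Finset.sum_congr rfl fun i' _ => by rw [integral_const_mul, hellell]
  have hb1 : ∀ u, ‖1 - φ (X u)‖ ≤ 1 := fun u => by rcases hψ01 u with h | h <;> simp [h]
  have hint : ∀ i, Integrable (fun u => (1 - φ (X u)) * ell i u) μ := fun i =>
    (helli i).bdd_mul (c := 1) (measurable_const.sub hφX).aestronglyMeasurable
      (Filter.Eventually.of_forall hb1)
  have hsplit : ∫ u, (1 - φ (X u)) * ∑ i, w i * ell i u ∂μ =
      ∑ i, w i * ∫ u, (1 - φ (X u)) * ell i u ∂μ := by
    simp_rw [Finset.mul_sum]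
    rw [integral_finsetSum]
    · refine Finset.sum_congr rfl fun i _ => ?_
      rw [← integral_const_mul]
      congr 1; funext u; ring
    · intro i _
      convert (hint i).const_mul (w i) using 2
      ring
  have hle1 : ∀ i, ∫ u, (1 - φ (X u)) * ell i u ∂μ ≤ 1 := fun i => by
    refine (integral_mono (hint i) (helli i) fun u => ?_).trans_eq (hell1 i)
    have := hell0 i u
    rcases hψ01 u with h | h <;> simp [h, this]
  have hbad : ∑ i ∈ Gᶜ, w i * ∫ u, (1 - φ (X u)) * ell i u ∂μ ≤ 1 / 8 :=
    le_trans (Finset.sum_le_sum fun i _ => mul_le_of_le_one_right (hw i) (hle1 i)) hG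
  rw [hsplit, ← Finset.sum_add_sum_compl G] at hsm
  linarith

/-! ### Gaussian noise -/

lemma exists_memP_gaussianReal {α : ℝ} (hα : 2 ≤ α) :
    ∃ K₀ : ℝ, 1 ≤ K₀ ∧ ∀ K, K₀ ≤ K → memP α K (gaussianReal 0 1) := by
  have hα0 : 0 ≤ α := by linarith
  have hi : Integrable (fun x : ℝ => |x| ^ α) (gaussianReal 0 1) := by
    have := (memLp_id_gaussianReal (μ := 0) (v := 1) α.toNNReal).integrable_norm_rpow'
    simpa [Real.coe_toNNReal α hα0, Real.norm_eq_abs] using this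
  set M := ∫ x : ℝ, |x| ^ α ∂(gaussianReal 0 1) with hM
  refine ⟨max 1 M, le_max_left _ _, fun K hK => ?_⟩
  have hK1 : 1 ≤ K := (le_max_left _ _).trans hK
  have hKM : M ≤ K := (le_max_right _ _).trans hK
  have hK0 : 0 < K := by linarith
  have hint : Integrable (fun x : ℝ => x) (gaussianReal 0 1) :=
    (memLp_id_gaussianReal (μ := 0) (v := 1) 1).integrable le_rfl
  have hsq : Integrable (fun x : ℝ => x ^ 2) (gaussianReal 0 1) :=
    (memLp_id_gaussianReal (μ := 0) (v := 1) 2).integrable_sq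
  refine ⟨inferInstance, hint, integral_id_gaussianReal, ?_, ?_⟩
  · rw [← ofReal_integral_eq_lintegral_ofReal hsq
      (Filter.Eventually.of_forall fun x => sq_nonneg x)]
    have hv := variance_fun_id_gaussianReal (μ := 0) (v := 1)
    rw [variance_eq_integral measurable_id'.aemeasurable] at hv
    simp only [integral_id_gaussianReal, sub_zero] at hv
    rw [hv]
    simp
  · have he : ∀ x : ℝ, |x / K| ^ α ≤ |x| ^ α * K⁻¹ := by
      intro x
      rw [abs_div, abs_of_pos hK0, Real.div_rpow (abs_nonneg _) hK0.le, div_eq_mul_inv]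
      refine mul_le_mul_of_nonneg_left (inv_anti₀ hK0 ?_) (by positivity)
      simpa using Real.rpow_le_rpow_of_exponent_le hK1 (by linarith : (1 : ℝ) ≤ α)
    calc ∫⁻ x, ENNReal.ofReal (|x / K| ^ α) ∂(gaussianReal 0 1)
        ≤ ∫⁻ x, ENNReal.ofReal (|x| ^ α * K⁻¹) ∂(gaussianReal 0 1) :=
          lintegral_mono fun x => ENNReal.ofReal_le_ofReal (he x)
      _ = ENNReal.ofReal (M * K⁻¹) := by
          rw [← ofReal_integral_eq_lintegral_ofReal (hi.mul_const _)
            (Filter.Eventually.of_forall fun x => by positivity), integral_mul_const]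
      _ ≤ 1 := by
          rw [ENNReal.ofReal_le_one, ← div_eq_mul_inv, div_le_one hK0]
          exact hKM

/-- The likelihood ratio of `N(δ,1)` with respect to `N(0,1)`. -/
noncomputable def gaussLR (δ x : ℝ) : ℝ := Real.exp (δ * x - δ ^ 2 / 2)

lemma measurable_gaussLR (δ : ℝ) : Measurable (gaussLR δ) := by unfold gaussLR; fun_prop

lemma gaussLR_mul_gaussLR (δ δ' x : ℝ) :
    gaussLR δ x * gaussLR δ' x =
      Real.exp (-(δ ^ 2 / 2 + δ' ^ 2 / 2)) * Real.exp ((δ + δ') * x) := by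
  simp only [gaussLR, ← Real.exp_add]
  congr 1
  ring

lemma integrable_gaussLR_mul (δ δ' : ℝ) :
    Integrable (fun x => gaussLR δ x * gaussLR δ' x) (gaussianReal 0 1) := by
  simp only [gaussLR_mul_gaussLR]
  exact (integrable_exp_mul_gaussianReal _).const_mul _

lemma integral_gaussLR_mul (δ δ' : ℝ) :
    ∫ x, gaussLR δ x * gaussLR δ' x ∂(gaussianReal 0 1) = Real.exp (δ * δ') := by
  simp only [gaussLR_mul_gaussLR]
  rw [integral_const_mul]
  have h := congrFun (mgf_id_gaussianReal (μ := 0) (v := 1)) (δ + δ')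
  simp only [mgf, id_eq] at h
  rw [h, ← Real.exp_add]
  congr 1
  push_cast
  ring

lemma gaussLR_zero (x : ℝ) : gaussLR 0 x = 1 := by simp [gaussLR]

lemma integrable_gaussLR (δ : ℝ) : Integrable (gaussLR δ) (gaussianReal 0 1) := by
  simpa [gaussLR_zero] using integrable_gaussLR_mul δ 0

lemma integral_gaussLR (δ : ℝ) : ∫ x, gaussLR δ x ∂(gaussianReal 0 1) = 1 := by
  simpa [gaussLR_zero] using integral_gaussLR_mul δ 0

lemma withDensity_gaussLR_map_sub (δ : ℝ) :
    ((gaussianReal 0 1).withDensity fun x => ENNReal.ofReal (gaussLR δ x)).map (fun x => x - δ) =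
      gaussianReal 0 1 := by
  have : (gaussianReal 0 1).withDensity (fun x => ENNReal.ofReal (gaussLR δ x)) =
      gaussianReal δ 1 := by
    rw [gaussianReal_of_var_ne_zero _ one_ne_zero, gaussianReal_of_var_ne_zero _ one_ne_zero,
      ← withDensity_mul _ (measurable_gaussianPDF _ _) (measurable_gaussLR δ).ennreal_ofReal]
    congr 1
    funext x
    simp only [Pi.mul_apply, gaussianPDF]
    rw [← ENNReal.ofReal_mul (gaussianPDFReal_nonneg _ _ _)]
    congr 1
    simp only [gaussianPDFReal, gaussLR]
    rw [mul_assoc, ← Real.exp_add]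
    congr 2
    push_cast
    ring
  rw [this, gaussianReal_map_sub_const, sub_self]

/-! ### Signals with an early change point -/

lemma early_change_mem_Theta1 {p n s t₀ : ℕ} {ρ : ℝ} (ht₀ : 1 ≤ t₀) (htn : 2 * t₀ ≤ n)
    (v : Fin p → ℝ) (hs : l0 p v ≤ s) (hρ : ρ ^ 2 ≤ (t₀ : ℝ) / 2 * sqnorm p v) :
    (fun (t : Fin n) j => if (t : ℕ) < t₀ then v j else 0) ∈ Theta1 p n s ρ := by
  simp only [Theta1, Set.mem_iUnion, Finset.mem_Icc]
  refine ⟨t₀, ⟨ht₀, by omega⟩, v, 0, fun t ht => by simp [ht], fun t ht => ?_, by simpa using hs,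
    hρ.trans ?_⟩
  · funext j
    simp [not_lt.mpr ht]
  · simp only [Pi.zero_apply, sub_zero]
    refine mul_le_mul_of_nonneg_right ?_ (Finset.sum_nonneg fun j _ => sq_nonneg _)
    have h1 : (2 : ℝ) * t₀ ≤ n := by exact_mod_cast htn
    have h2 : (1 : ℝ) ≤ t₀ := by exact_mod_cast ht₀
    rw [div_le_div_iff₀ two_pos (by linarith)]
    nlinarith

/-! ### The geometric grid of change points -/

lemma sum_half_pow_dist_le (M : ℕ) :
    ∑ k ∈ Finset.range M, ∑ l ∈ Finset.range M, (1 / 2 : ℝ) ^ ((k - l) + (l - k)) ≤ 3 * M := by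
  induction M with
  | zero => simp
  | succ M ih =>
    have hrow : ∑ l ∈ Finset.range M, (1 / 2 : ℝ) ^ ((M - l) + (l - M)) ≤ 1 := by
      have h : ∀ M : ℕ, ∑ l ∈ Finset.range M, (1 / 2 : ℝ) ^ (M - l) = 1 - (1 / 2) ^ M := by
        intro M
        induction M with
        | zero => simp
        | succ M ih =>
          rw [Finset.sum_range_succ]
          have : ∑ l ∈ Finset.range M, (1 / 2 : ℝ) ^ (M + 1 - l) =
              1 / 2 * ∑ l ∈ Finset.range M, (1 / 2 : ℝ) ^ (M - l) := by
            rw [Finset.mul_sum]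
            refine Finset.sum_congr rfl fun l hl => ?_
            rw [Nat.sub_add_comm (Finset.mem_range.mp hl).le, pow_succ, mul_comm]
          rw [this, ih, Nat.add_sub_cancel_left, pow_succ]
          ring
      calc ∑ l ∈ Finset.range M, (1 / 2 : ℝ) ^ ((M - l) + (l - M))
          = ∑ l ∈ Finset.range M, (1 / 2 : ℝ) ^ (M - l) := by
            refine Finset.sum_congr rfl fun l hl => ?_
            rw [Nat.sub_eq_zero_of_le (Finset.mem_range.mp hl).le, add_zero]
        _ ≤ 1 := by rw [h]; linarith [pow_pos (by norm_num : (0 : ℝ) < 1 / 2) M]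
    simp only [Finset.sum_range_succ, Finset.sum_add_distrib]
    have hcol : ∑ l ∈ Finset.range M, (1 / 2 : ℝ) ^ ((l - M) + (M - l)) ≤ 1 := by
      simpa only [add_comm] using hrow
    simp only [Nat.sub_self, add_zero, pow_zero]
    push_cast
    linarith

/-- The number of points of the grid `{1, 4, 16, …}` below `n / 2`. -/
def gridSize (n : ℕ) : ℕ := Nat.log 4 (n / 2) + 1

lemma two_mul_four_pow_le {n : ℕ} (hn : 2 ≤ n) (k : Fin (gridSize n)) :
    2 * 4 ^ (k : ℕ) ≤ n := by
  have h1 : 4 ^ (k : ℕ) ≤ n / 2 :=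
    Nat.pow_le_of_le_log (by omega) (by have := k.2; unfold gridSize at this; omega)
  omega

lemma LL_pos {n : ℕ} (hn : 2 ≤ n) : 0 < LL n := by
  have hn' : (2 : ℝ) ≤ n := by exact_mod_cast hn
  have h1 : 1 < Real.log (8 * n) := by
    rw [Real.lt_log_iff_exp_lt (by linarith)]
    linarith [Real.exp_one_lt_d9]
  exact Real.log_pos h1

lemma exp_mul_LL_le {n : ℕ} (hn : 2 ≤ n) {c : ℝ} (hc0 : 0 ≤ c) (hc1 : c ≤ 1) :
    Real.exp (c * LL n) ≤ 1 + 5 * c * gridSize n := by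
  have hn' : (2 : ℝ) ≤ n := by exact_mod_cast hn
  set M := gridSize n with hM
  have hM1 : (1 : ℝ) ≤ M := by
    have : 1 ≤ M := by rw [hM, gridSize]; omega
    exact_mod_cast this
  have hlt : n ≤ 2 * 4 ^ M := by
    have := Nat.lt_pow_succ_log_self (b := 4) (by norm_num) (n / 2)
    change n / 2 < 4 ^ M at this
    omega
  have hlt' : (8 : ℝ) * n ≤ 4 ^ (M + 2) := by
    have : (n : ℝ) ≤ 2 * 4 ^ M := by exact_mod_cast hlt
    rw [pow_add]; linarith
  have hlog1 : 1 < Real.log (8 * n) := by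
    rw [Real.lt_log_iff_exp_lt (by linarith)]
    linarith [Real.exp_one_lt_d9]
  have hlog : Real.log (8 * n) ≤ 1 + (2 * M + 3) := by
    calc Real.log (8 * n) ≤ Real.log (4 ^ (M + 2)) := Real.log_le_log (by linarith) hlt'
      _ = (M + 2) * Real.log 4 := by rw [Real.log_pow]; push_cast; ring
      _ ≤ (M + 2) * 2 := by
          refine mul_le_mul_of_nonneg_left ?_ (by positivity)
          rw [show (4 : ℝ) = 2 ^ 2 by norm_num, Real.log_pow]
          push_cast
          linarith [Real.log_two_lt_d9]
      _ = 1 + (2 * M + 3) := by ring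
  calc Real.exp (c * LL n) = Real.log (8 * n) ^ c := by
        rw [Real.rpow_def_of_pos (by linarith), LL, mul_comm]
    _ ≤ (1 + (2 * M + 3 : ℝ)) ^ c := Real.rpow_le_rpow (by linarith) hlog hc0
    _ ≤ 1 + c * (2 * M + 3) := rpow_one_add_le_one_add_mul_self (by linarith) hc0 hc1
    _ ≤ 1 + 5 * c * M := by nlinarith

lemma grid_average_exp_le {n : ℕ} (hn : 2 ≤ n) :
    ∑ k : Fin (gridSize n), ∑ l : Fin (gridSize n), (1 / (gridSize n : ℝ)) * (1 / gridSize n) *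
      Real.exp (LL n / 144 * (1 / 2 : ℝ) ^ (((k : ℕ) - l) + ((l : ℕ) - k))) ≤ 9 / 8 := by
  set M := gridSize n with hM
  have hM1 : (1 : ℝ) ≤ M := by
    have : 1 ≤ M := by rw [hM, gridSize]; omega
    exact_mod_cast this
  have hM0 : (0 : ℝ) < M := by linarith
  have hexp := exp_mul_LL_le hn (c := 1 / 144) (by norm_num) (by norm_num)
  rw [← hM, one_div_mul_eq_div] at hexp
  set κ := LL n / 144
  have hconv : ∀ x : ℝ, 0 ≤ x → x ≤ 1 → Real.exp (κ * x) ≤ 1 + x * (Real.exp κ - 1) := by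
    intro x hx0 hx1
    have := convexOn_exp.2 (Set.mem_univ (0 : ℝ)) (Set.mem_univ κ) (sub_nonneg.mpr hx1) hx0
      (by ring)
    simp only [smul_eq_mul, mul_zero, zero_add, Real.exp_zero, mul_one] at this
    rw [mul_comm κ x]
    linarith
  have hterm : ∀ k l : Fin M, (1 / (M : ℝ)) * (1 / M) *
      Real.exp (κ * (1 / 2 : ℝ) ^ (((k : ℕ) - l) + ((l : ℕ) - k))) ≤ (1 / (M : ℝ)) * (1 / M) *
      (1 + (1 / 2 : ℝ) ^ (((k : ℕ) - l) + ((l : ℕ) - k)) * (5 * (1 / 144) * M)) := by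
    intro k l
    refine mul_le_mul_of_nonneg_left ?_ (by positivity)
    refine (hconv _ (by positivity) (pow_le_one₀ (by norm_num) (by norm_num))).trans ?_
    have : (0 : ℝ) ≤ (1 / 2 : ℝ) ^ (((k : ℕ) - l) + ((l : ℕ) - k)) := by positivity
    nlinarith
  refine (Finset.sum_le_sum fun k _ => Finset.sum_le_sum fun l _ => hterm k l).trans ?_
  have hS : ∑ k : Fin M, ∑ l : Fin M, (1 / 2 : ℝ) ^ (((k : ℕ) - l) + ((l : ℕ) - k)) ≤ 3 * M := by
    have := sum_half_pow_dist_le M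
    rw [Finset.sum_range] at this
    refine le_trans (le_of_eq (Finset.sum_congr rfl fun k _ => ?_)) this
    rw [Finset.sum_range]
  simp only [← Finset.mul_sum, Finset.sum_add_distrib, ← Finset.sum_mul]
  simp only [Finset.sum_const, Finset.card_univ, Fintype.card_fin, nsmul_eq_mul, mul_one]
  have : (1 / (M : ℝ)) * (1 / M) * (M * M + 3 * M * (5 * (1 / 144) * M)) ≤ 9 / 8 := by
    field_simp
    norm_num
  refine le_trans ?_ this
  gcongr

/-! ### The sparse sign prior -/

/-- The values of a sparse sign. -/
noncomputable def signVal : Fin 3 → ℝ := ![0, 1, -1]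

/-- A sparse sign is zero with probability `1 - q`, and uniform on `±1` otherwise. -/
noncomputable def signWeight (q : ℝ) : Fin 3 → ℝ := ![1 - q, q / 2, q / 2]

/-- The number of nonzero signs. -/
def supportSize {p : ℕ} (σ : Fin p → Fin 3) : ℕ := (Finset.univ.filter fun j => σ j ≠ 0).card

lemma signWeight_nonneg {q : ℝ} (hq0 : 0 ≤ q) (hq1 : q ≤ 1) (u : Fin 3) : 0 ≤ signWeight q u := by
  fin_cases u <;> simp [signWeight] <;> linarith

lemma sum_prod_eq_prod_sum {p : ℕ} {κ : Type*} [Fintype κ] (f : Fin p → κ → ℝ) :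
    ∑ σ : Fin p → κ, ∏ j, f j (σ j) = ∏ j, ∑ u, f j u := by
  rw [Finset.prod_univ_sum, Fintype.piFinset_univ]

lemma sum_sum_prod_eq_pow {p : ℕ} {κ : Type*} [Fintype κ] (F : κ → κ → ℝ) :
    ∑ σ : Fin p → κ, ∑ τ : Fin p → κ, ∏ j, F (σ j) (τ j) = (∑ u, ∑ v, F u v) ^ p := by
  have : ∀ σ : Fin p → κ, ∑ τ : Fin p → κ, ∏ j, F (σ j) (τ j) = ∏ j, ∑ v, F (σ j) v :=
    fun σ => sum_prod_eq_prod_sum fun j v => F (σ j) v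
  simp only [this]
  rw [sum_prod_eq_prod_sum fun _ u => ∑ v, F u v]
  simp

lemma sum_prod_signWeight (p : ℕ) (q : ℝ) :
    ∑ σ : Fin p → Fin 3, ∏ j, signWeight q (σ j) = 1 := by
  rw [sum_prod_eq_prod_sum fun _ u => signWeight q u]
  refine Finset.prod_eq_one fun j _ => ?_
  simp [Fin.sum_univ_three, signWeight]
  ring

lemma sum_exp_supportSize_le (p : ℕ) {q : ℝ} (hq0 : 0 ≤ q) (hq1 : q ≤ 1) (b : ℝ) :
    ∑ σ : Fin p → Fin 3, (∏ j, signWeight q (σ j)) * Real.exp (b * supportSize σ) ≤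
      Real.exp (p * (q * (Real.exp b - 1))) := by
  have h : ∀ σ : Fin p → Fin 3, (∏ j, signWeight q (σ j)) * Real.exp (b * supportSize σ) =
      ∏ j, signWeight q (σ j) * (if σ j ≠ 0 then Real.exp b else 1) := by
    intro σ
    rw [Finset.prod_mul_distrib, ← Finset.prod_filter, Finset.prod_const, ← Real.exp_nat_mul,
      supportSize, mul_comm b]
  simp only [h]
  rw [sum_prod_eq_prod_sum fun _ u => signWeight q u * (if u ≠ 0 then Real.exp b else 1)]
  simp only [Finset.prod_const, Finset.card_univ, Fintype.card_fin]
  rw [Real.exp_nat_mul]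
  have hs : ∑ u : Fin 3, signWeight q u * (if u ≠ 0 then Real.exp b else 1) =
      q * (Real.exp b - 1) + 1 := by
    simp [Fin.sum_univ_three, signWeight]
    ring
  rw [hs]
  refine pow_le_pow_left₀ ?_ (Real.add_one_le_exp _) p
  nlinarith [Real.exp_pos b]

lemma sum_atypical_le (p : ℕ) {q m : ℝ} (hq0 : 0 ≤ q) (hq1 : q ≤ 1) (hm : 1024 ≤ m)
    (hpq : p * q = m / 4) :
    ∑ σ ∈ (Finset.univ.filter fun σ : Fin p → Fin 3 =>
        m / 16 ≤ supportSize σ ∧ (supportSize σ : ℝ) ≤ m)ᶜ,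
      ∏ j, signWeight q (σ j) ≤ 1 / 8 := by
  have hw : ∀ σ : Fin p → Fin 3, 0 ≤ ∏ j, signWeight q (σ j) := fun σ =>
    Finset.prod_nonneg fun j _ => signWeight_nonneg hq0 hq1 _
  have hpt : ∀ σ ∈ (Finset.univ.filter fun σ : Fin p → Fin 3 =>
      m / 16 ≤ supportSize σ ∧ (supportSize σ : ℝ) ≤ m)ᶜ, ∏ j, signWeight q (σ j) ≤
      (∏ j, signWeight q (σ j)) * Real.exp (1 * supportSize σ) * Real.exp (-m) +
      (∏ j, signWeight q (σ j)) * Real.exp (-1 * supportSize σ) * Real.exp (m / 16) := by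
    intro σ hσ
    simp only [Finset.mem_compl, Finset.mem_filter, Finset.mem_univ, true_and, not_and_or,
      not_le] at hσ
    rw [mul_assoc, mul_assoc, ← Real.exp_add, ← Real.exp_add, ← mul_add]
    refine le_mul_of_one_le_right (hw σ) ?_
    rcases hσ with h | h
    · have := Real.one_le_exp (x := -1 * (supportSize σ : ℝ) + m / 16) (by linarith)
      linarith [Real.exp_pos (1 * (supportSize σ : ℝ) + -m)]
    · have := Real.one_le_exp (x := 1 * (supportSize σ : ℝ) + -m) (by linarith)
      linarith [Real.exp_pos (-1 * (supportSize σ : ℝ) + m / 16)]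
  have hup := sum_exp_supportSize_le p hq0 hq1 1
  have hlo := sum_exp_supportSize_le p hq0 hq1 (-1)
  have he1 : Real.exp 1 ≤ 3 := by linarith [Real.exp_one_lt_d9]
  have he2 : Real.exp (-1) ≤ 1 / 2 := by
    rw [Real.exp_neg, one_div]
    exact inv_anti₀ two_pos (by linarith [Real.exp_one_gt_d9])
  have hsmall : ∀ x : ℝ, 63 ≤ x → Real.exp (-x) ≤ 1 / 16 := by
    intro x hx
    rw [Real.exp_neg, one_div]
    exact inv_anti₀ (by norm_num) (by linarith [Real.add_one_le_exp x])
  have hA : Real.exp (p * (q * (Real.exp 1 - 1))) * Real.exp (-m) ≤ 1 / 16 := by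
    rw [← Real.exp_add, ← mul_assoc, hpq]
    refine le_trans (Real.exp_le_exp.mpr ?_) (hsmall (m / 2) (by linarith))
    nlinarith
  have hB : Real.exp (p * (q * (Real.exp (-1) - 1))) * Real.exp (m / 16) ≤ 1 / 16 := by
    rw [← Real.exp_add, ← mul_assoc, hpq]
    refine le_trans (Real.exp_le_exp.mpr ?_) (hsmall (m / 16) (by linarith))
    nlinarith
  calc _ ≤ ∑ σ ∈ (Finset.univ.filter fun σ : Fin p → Fin 3 =>
          m / 16 ≤ supportSize σ ∧ (supportSize σ : ℝ) ≤ m)ᶜ,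
          ((∏ j, signWeight q (σ j)) * Real.exp (1 * supportSize σ) * Real.exp (-m) +
          (∏ j, signWeight q (σ j)) * Real.exp (-1 * supportSize σ) * Real.exp (m / 16)) :=
        Finset.sum_le_sum hpt
    _ ≤ ∑ σ : Fin p → Fin 3,
          ((∏ j, signWeight q (σ j)) * Real.exp (1 * supportSize σ) * Real.exp (-m) +
          (∏ j, signWeight q (σ j)) * Real.exp (-1 * supportSize σ) * Real.exp (m / 16)) :=
        Finset.sum_le_univ_sum_of_nonneg fun σ => by have := hw σ; positivity
    _ ≤ Real.exp (p * (q * (Real.exp 1 - 1))) * Real.exp (-m) +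
          Real.exp (p * (q * (Real.exp (-1) - 1))) * Real.exp (m / 16) := by
        rw [Finset.sum_add_distrib, ← Finset.sum_mul, ← Finset.sum_mul]
        gcongr
    _ ≤ 1 / 8 := by linarith

lemma l0_mul_signVal_le {p : ℕ} (a : ℝ) (σ : Fin p → Fin 3) :
    l0 p (fun j => a * signVal (σ j)) ≤ supportSize σ := by
  refine Finset.card_le_card fun j => ?_
  simp only [Finset.mem_filter, Finset.mem_univ, true_and]
  intro h h0
  simp [h0, signVal] at h

lemma sqnorm_mul_signVal {p : ℕ} (a : ℝ) (σ : Fin p → Fin 3) :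
    sqnorm p (fun j => a * signVal (σ j)) = a ^ 2 * supportSize σ := by
  have : ∀ u : Fin 3, (a * signVal u) ^ 2 = a ^ 2 * if u ≠ 0 then 1 else 0 := by
    intro u
    fin_cases u <;> simp [signVal]
  simp only [sqnorm, this, ← Finset.mul_sum, supportSize]
  rw [Finset.sum_boole]

/-! ### Lower bounds with Gaussian noise -/

lemma half_le_risk_gaussian {p n s : ℕ} {α K ρ : ℝ} {φ : (Fin n → Fin p → ℝ) → ℝ}
    {ι : Type*} [Fintype ι] (hφ : IsTest p n φ) (hmem : memP α K (gaussianReal 0 1))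
    (w : ι → ℝ) (hw : ∀ i, 0 ≤ w i) (hw1 : ∑ i, w i = 1) (τ : ι → ℕ) (hτ : ∀ i, 1 ≤ τ i)
    (hτn : ∀ i, 2 * τ i ≤ n) (v : ι → Fin p → ℝ)
    (hsecond : ∑ i, ∑ i', w i * w i' *
      ∏ j, Real.exp ((min (τ i) (τ i') : ℕ) * (v i j * v i' j)) ≤ 9 / 8)
    (G : Finset ι) (hG : ∑ i ∈ Gᶜ, w i ≤ 1 / 8) (hs : ∀ i ∈ G, l0 p (v i) ≤ s)
    (hρ : ∀ i ∈ G, ρ ^ 2 ≤ (τ i : ℝ) / 2 * sqnorm p (v i)) :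
    1 / 2 ≤ risk p n (Pclass p n α K) (Theta1 p n s ρ) φ := by
  set θ : ι → Fin n → Fin p → ℝ := fun i t j => if (t : ℕ) < τ i then v i j else 0 with hθ
  refine half_le_risk_of_second_moment hφ (gaussianReal 0 1) id measurable_id (by simpa using hmem)
    w hw hw1 θ (fun i t j => gaussLR (θ i t j)) (fun i t j => measurable_gaussLR _)
    (fun i t j x => (Real.exp_pos _).le) (fun i t j => integrable_gaussLR _)
    (fun i t j => integral_gaussLR _) (fun i i' t j => integrable_gaussLR_mul _ _) ?_ G hG
    (fun i hi => early_change_mem_Theta1 (hτ i) (hτn i) (v i) (hs i hi) (hρ i hi))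
    (fun i _ t j => ?_)
  · refine le_trans (le_of_eq ?_) hsecond
    refine Finset.sum_congr rfl fun i _ => Finset.sum_congr rfl fun i' _ => ?_
    congr 1
    rw [Finset.prod_comm]
    refine Finset.prod_congr rfl fun j _ => ?_
    simp only [integral_gaussLR_mul]
    rw [← Real.exp_sum]
    congr 1
    have : ∀ t : Fin n, θ i t j * θ i' t j =
        if (t : ℕ) < min (τ i) (τ i') then v i j * v i' j else 0 := by
      intro t
      simp only [hθ, lt_min_iff]
      split_ifs <;> simp_all
    simp only [this]
    rw [Finset.sum_ite, Finset.sum_const_zero, add_zero, Finset.sum_const, nsmul_eq_mul]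
    congr 2
    have hm : min (τ i) (τ i') ≤ n := by have := hτn i; omega
    rw [Fin.card_filter_val_lt, min_eq_right hm]
  · simp only [id_eq]
    rw [withDensity_gaussLR_map_sub]
    exact hmem

lemma min_four_pow_mul (k l : ℕ) (x y : ℝ) :
    ((min (4 ^ k) (4 ^ l) : ℕ) : ℝ) * (x / 2 ^ k * (y / 2 ^ l)) =
      x * y * (1 / 2 : ℝ) ^ ((k - l) + (l - k)) := by
  wlog h : k ≤ l generalizing k l x y
  · have := this l k y x (by omega)
    rw [min_comm, mul_comm (x / _), this, add_comm (k - l), mul_comm y]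
  · rw [min_eq_left (Nat.pow_le_pow_right (by norm_num) h), Nat.sub_eq_zero_of_le h, zero_add]
    obtain ⟨d, rfl⟩ := Nat.exists_eq_add_of_le h
    rw [Nat.add_sub_cancel_left, pow_add, one_div, inv_pow]
    push_cast
    rw [show (4 : ℝ) = 2 ^ 2 by norm_num, ← pow_mul, mul_comm 2 k, pow_mul]
    field_simp

lemma four_pow_div_two_mul_sqnorm {p : ℕ} (k : ℕ) (u : Fin p → ℝ) :
    ((4 ^ k : ℕ) : ℝ) / 2 * sqnorm p (fun j => u j / 2 ^ k) = sqnorm p u / 2 := by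
  have : sqnorm p (fun j => u j / 2 ^ k) = sqnorm p u / 4 ^ k := by
    simp only [sqnorm, Finset.sum_div]
    refine Finset.sum_congr rfl fun j _ => ?_
    rw [div_pow, ← pow_mul, mul_comm k 2, pow_mul]
    norm_num
  rw [this]
  push_cast
  field_simp

lemma l0_div {p : ℕ} {c : ℝ} (hc : c ≠ 0) (u : Fin p → ℝ) :
    l0 p (fun j => u j / c) = l0 p u := by
  simp [l0, hc]

lemma sum_uniform_grid (n : ℕ) : ∑ _k : Fin (gridSize n), 1 / (gridSize n : ℝ) = 1 := by
  have : (gridSize n : ℝ) ≠ 0 := by unfold gridSize; positivity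
  simp [this]

lemma half_le_risk_of_sq_le_LL {p n s : ℕ} {α K ρ : ℝ} {φ : (Fin n → Fin p → ℝ) → ℝ}
    (hφ : IsTest p n φ) (hmem : memP α K (gaussianReal 0 1)) (hn : 2 ≤ n) (hp : 0 < p)
    (hs : 1 ≤ s) (hρ : ρ ^ 2 ≤ LL n / 288) :
    1 / 2 ≤ risk p n (Pclass p n α K) (Theta1 p n s ρ) φ := by
  have hL := LL_pos hn
  set u : Fin p → ℝ := Pi.single ⟨0, hp⟩ √(LL n / 144) with hu
  have huu : ∑ j, u j * u j = LL n / 144 := by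
    rw [Finset.sum_eq_single ⟨0, hp⟩]
    · simp only [hu, Pi.single_eq_same]
      exact Real.mul_self_sqrt (by positivity)
    · intro j _ hj
      simp [hu, hj]
    · simp
  refine half_le_risk_gaussian hφ hmem (fun _ : Fin (gridSize n) => 1 / (gridSize n : ℝ))
    (fun _ => by positivity) (sum_uniform_grid n) (fun k => 4 ^ (k : ℕ))
    (fun k => Nat.one_le_pow _ _ (by norm_num)) (fun k => two_mul_four_pow_le hn k)
    (fun k j => u j / 2 ^ (k : ℕ)) ?_ Finset.univ (by simp) ?_ ?_
  · refine le_trans (le_of_eq ?_) (grid_average_exp_le hn)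
    refine Finset.sum_congr rfl fun k _ => Finset.sum_congr rfl fun l _ => ?_
    congr 1
    simp only [min_four_pow_mul]
    rw [← Real.exp_sum, ← Finset.sum_mul, huu]
  · intro k _
    rw [l0_div (by positivity)]
    refine le_trans ?_ hs
    refine (Finset.card_le_card fun j => ?_).trans (Finset.card_singleton (⟨0, hp⟩ : Fin p)).le
    simp only [Finset.mem_filter, Finset.mem_univ, true_and, Finset.mem_singleton]
    intro h
    by_contra h0
    simp [hu, h0] at h
  · intro k _
    rw [four_pow_div_two_mul_sqnorm]
    have : sqnorm p u = LL n / 144 := by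
      rw [← huu]
      exact Finset.sum_congr rfl fun j _ => sq (u j)
    rw [this]
    linarith

lemma exp_add_exp_neg_le {x : ℝ} (hx0 : 0 ≤ x) (hx1 : x ≤ 1) :
    (Real.exp x + Real.exp (-x)) / 2 ≤ 1 + x ^ 2 := by
  have h1 := Real.abs_exp_sub_one_sub_id_le (x := x) (by rwa [abs_of_nonneg hx0])
  have h2 := Real.abs_exp_sub_one_sub_id_le (x := -x) (by rwa [abs_neg, abs_of_nonneg hx0])
  have h3 := le_abs_self (Real.exp x - 1 - x)
  have h4 := le_abs_self (Real.exp (-x) - 1 - -x)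
  nlinarith

lemma sum_signWeight_exp_le {q y : ℝ} (hy0 : 0 ≤ y) (hy1 : y ≤ 1) :
    ∑ u, ∑ u', signWeight q u * signWeight q u' * Real.exp (y * (signVal u * signVal u')) ≤
      Real.exp (q ^ 2 * y ^ 2) := by
  have h : ∑ u, ∑ u', signWeight q u * signWeight q u' *
      Real.exp (y * (signVal u * signVal u')) =
      1 + q ^ 2 * ((Real.exp y + Real.exp (-y)) / 2 - 1) := by
    simp [Fin.sum_univ_three, signWeight, signVal]
    ring
  rw [h]
  have := mul_le_mul_of_nonneg_left (exp_add_exp_neg_le hy0 hy1) (sq_nonneg q)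
  linarith [Real.add_one_le_exp (q ^ 2 * y ^ 2)]

lemma half_le_risk_of_sq_le_sqrt {p n s : ℕ} {α K ρ : ℝ} {φ : (Fin n → Fin p → ℝ) → ℝ}
    (hφ : IsTest p n φ) (hmem : memP α K (gaussianReal 0 1)) (hn : 2 ≤ n)
    (hs : 1024 ≤ s) (hsp : s ≤ p) (hs2 : √(p * LL n) < s) (hρ : ρ ^ 2 ≤ √(p * LL n) / 96) :
    1 / 2 ≤ risk p n (Pclass p n α K) (Theta1 p n s ρ) φ := by
  have hL := LL_pos hn
  have hs' : (1024 : ℝ) ≤ s := by exact_mod_cast hs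
  have hs0 : (0 : ℝ) < s := by linarith
  have hsp' : (s : ℝ) ≤ p := by exact_mod_cast hsp
  have hp0 : (0 : ℝ) < p := by linarith
  set q : ℝ := s / (4 * p) with hq
  have hq0 : 0 ≤ q := by positivity
  have hq1 : q ≤ 1 := by rw [hq, div_le_one (by positivity)]; linarith
  set A : ℝ := √(p * LL n) / (3 * s) with hA
  have hA0 : 0 ≤ A := by positivity
  have hA1 : A ≤ 1 := by rw [hA, div_le_one (by positivity)]; linarith
  have hAA : p * (q ^ 2 * A ^ 2) = LL n / 144 := by
    rw [hq, hA, div_pow, div_pow, Real.sq_sqrt (by positivity)]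
    field_simp
    norm_num
  set G : Finset (Fin p → Fin 3) := Finset.univ.filter fun σ : Fin p → Fin 3 =>
        (s : ℝ) / 16 ≤ supportSize σ ∧ (supportSize σ : ℝ) ≤ s with hG
  have hGw := sum_atypical_le p hq0 hq1 hs' (by rw [hq]; field_simp)
  have hA2 : √A * √A = A := Real.mul_self_sqrt hA0
  refine half_le_risk_gaussian hφ hmem
    (fun i : Fin (gridSize n) × (Fin p → Fin 3) =>
      1 / (gridSize n : ℝ) * ∏ j, signWeight q (i.2 j))
    (fun i => mul_nonneg (by positivity) (Finset.prod_nonneg fun j _ =>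
      signWeight_nonneg hq0 hq1 _)) ?_ (fun i => 4 ^ (i.1 : ℕ))
    (fun k => Nat.one_le_pow _ _ (by norm_num)) (fun i => two_mul_four_pow_le hn i.1)
    (fun i j => √A * signVal (i.2 j) / 2 ^ (i.1 : ℕ)) ?_ (Finset.univ ×ˢ G) ?_ ?_ ?_
  · rw [Fintype.sum_prod_type]
    simp only [← Finset.mul_sum, sum_prod_signWeight, mul_one]
    exact sum_uniform_grid n
  · refine le_trans ?_ (grid_average_exp_le hn)
    simp only [Fintype.sum_prod_type, min_four_pow_mul]
    refine Finset.sum_le_sum fun k _ => ?_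
    rw [Finset.sum_comm]
    refine Finset.sum_le_sum fun l _ => ?_
    set x : ℝ := (1 / 2 : ℝ) ^ (((k : ℕ) - l) + ((l : ℕ) - k)) with hx
    have hx0 : 0 ≤ x := by positivity
    have hx1 : x ≤ 1 := pow_le_one₀ (by norm_num) (by norm_num)
    have hxe : ∀ u u' : Fin 3, √A * signVal u * (√A * signVal u') * x =
        A * x * (signVal u * signVal u') := fun u u' => by
      linear_combination signVal u * signVal u' * x * hA2
    have hrw : ∀ σ σ' : Fin p → Fin 3,
        1 / (gridSize n : ℝ) * (∏ j, signWeight q (σ j)) *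
          (1 / (gridSize n : ℝ) * ∏ j, signWeight q (σ' j)) *
          ∏ j, Real.exp (√A * signVal (σ j) * (√A * signVal (σ' j)) * x) =
        1 / (gridSize n : ℝ) * (1 / (gridSize n : ℝ)) * ∏ j, (signWeight q (σ j) *
          signWeight q (σ' j) * Real.exp (A * x * (signVal (σ j) * signVal (σ' j)))) := by
      intro σ σ'
      simp only [Finset.prod_mul_distrib, hxe]
      ring
    simp only [hrw, ← Finset.mul_sum]
    refine mul_le_mul_of_nonneg_left ?_ (by positivity)
    rw [sum_sum_prod_eq_pow fun u u' => signWeight q u * signWeight q u' *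
      Real.exp (A * x * (signVal u * signVal u'))]
    have hxA : A * x ≤ 1 := mul_le_one₀ hA1 hx0 hx1
    refine (pow_le_pow_left₀ ?_ (sum_signWeight_exp_le (mul_nonneg hA0 hx0) hxA) p).trans ?_
    · exact Finset.sum_nonneg fun u _ => Finset.sum_nonneg fun u' _ =>
        mul_nonneg (mul_nonneg (signWeight_nonneg hq0 hq1 _) (signWeight_nonneg hq0 hq1 _))
          (Real.exp_pos _).le
    · rw [← Real.exp_nat_mul, Real.exp_le_exp, mul_pow, ← hAA]
      have : x ^ 2 ≤ x := by nlinarith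
      have h0 : 0 ≤ (p : ℝ) * (q ^ 2 * A ^ 2) := by positivity
      nlinarith [mul_le_mul_of_nonneg_left this h0]
  · refine (Finset.sum_congr (s₂ := Finset.univ ×ˢ Gᶜ) (by ext i; simp) fun _ _ => rfl).trans_le ?_
    rw [Finset.sum_product]
    dsimp only
    rw [← Finset.sum_mul_sum, sum_uniform_grid, one_mul]
    exact hGw
  · intro i hi
    have hi' := (Finset.mem_filter.mp (Finset.mem_product.mp hi).2).2
    rw [l0_div (by positivity)]
    refine (l0_mul_signVal_le _ _).trans ?_
    exact_mod_cast hi'.2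
  · intro i hi
    have hi' := (Finset.mem_filter.mp (Finset.mem_product.mp hi).2).2
    rw [four_pow_div_two_mul_sqnorm, sqnorm_mul_signVal, sq √A, hA2]
    have h1 : A * (s / 16) ≤ A * supportSize i.2 := mul_le_mul_of_nonneg_left hi'.1 hA0
    have h2 : A * s = √(p * LL n) / 3 := by rw [hA]; field_simp
    linarith

/-! ### Finitely supported noise -/

/-- The measure with masses `r` on a finite type. -/
noncomputable def finMeasure {Y : Type*} [MeasurableSpace Y] (r : Y → ℝ) : Measure Y :=
  Measure.count.withDensity fun y => ENNReal.ofReal (r y)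

section FinMeasure

variable {Y : Type*} [Fintype Y] [MeasurableSpace Y] [DiscreteMeasurableSpace Y]

lemma finMeasure_singleton (r : Y → ℝ) (y : Y) : finMeasure r {y} = ENNReal.ofReal (r y) := by
  rw [finMeasure, withDensity_apply _ (measurableSet_singleton y), lintegral_singleton,
    Measure.count_singleton, mul_one]

instance isFiniteMeasure_finMeasure (r : Y → ℝ) : IsFiniteMeasure (finMeasure r) := by
  refine ⟨?_⟩
  rw [finMeasure, withDensity_apply _ MeasurableSet.univ, Measure.restrict_univ,
    lintegral_count, tsum_fintype]
  exact ENNReal.sum_lt_top.mpr fun _ _ => ENNReal.ofReal_lt_top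

lemma integral_finMeasure {r : Y → ℝ} (hr : ∀ y, 0 ≤ r y) (f : Y → ℝ) :
    ∫ y, f y ∂(finMeasure r) = ∑ y, r y * f y := by
  rw [integral_fintype Integrable.of_finite]
  refine Finset.sum_congr rfl fun y _ => ?_
  rw [measureReal_def, finMeasure_singleton, ENNReal.toReal_ofReal (hr y), smul_eq_mul]

lemma isProbabilityMeasure_finMeasure {r : Y → ℝ} (hr : ∀ y, 0 ≤ r y) (h1 : ∑ y, r y = 1) :
    IsProbabilityMeasure (finMeasure r) := by
  refine ⟨?_⟩
  rw [finMeasure, withDensity_apply _ MeasurableSet.univ, Measure.restrict_univ,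
    lintegral_count, tsum_fintype, ← ENNReal.ofReal_sum_of_nonneg fun y _ => hr y, h1,
    ENNReal.ofReal_one]

lemma withDensity_finMeasure {r : Y → ℝ} (hr : ∀ y, 0 ≤ r y) (g : Y → ℝ) :
    (finMeasure r).withDensity (fun y => ENNReal.ofReal (g y)) = finMeasure fun y => r y * g y := by
  rw [finMeasure, finMeasure, ← withDensity_mul _ (measurable_of_finite _)
    (measurable_of_finite _)]
  congr 1
  funext y
  rw [Pi.mul_apply, ENNReal.ofReal_mul (hr y)]

lemma memP_finMeasure_map {α K : ℝ} {r : Y → ℝ} (hr : ∀ y, 0 ≤ r y) (h1 : ∑ y, r y = 1)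
    {T : Y → ℝ} (hmean : ∑ y, r y * T y = 0) (hvar : ∑ y, r y * T y ^ 2 = 1)
    (hα : ∑ y, r y * |T y / K| ^ α ≤ 1) : memP α K ((finMeasure r).map T) := by
  have := isProbabilityMeasure_finMeasure hr h1
  have hT : Measurable T := measurable_of_finite _
  have hl : ∀ f : ℝ → ℝ, Measurable f → (∀ x, 0 ≤ f x) →
      ∫⁻ x, ENNReal.ofReal (f x) ∂((finMeasure r).map T) =
        ENNReal.ofReal (∑ y, r y * f (T y)) := by
    intro f hf hf0
    rw [lintegral_map hf.ennreal_ofReal hT, ← integral_finMeasure hr fun y => f (T y),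
      ofReal_integral_eq_lintegral_ofReal Integrable.of_finite
        (Filter.Eventually.of_forall fun y => hf0 _)]
  refine ⟨Measure.isProbabilityMeasure_map hT.aemeasurable, ?_, ?_, ?_, ?_⟩
  · rw [integrable_map_measure measurable_id.aestronglyMeasurable hT.aemeasurable]
    exact Integrable.of_finite
  · rw [integral_map hT.aemeasurable measurable_id'.aestronglyMeasurable,
      integral_finMeasure hr, hmean]
  · rw [hl (fun x => x ^ 2) (by fun_prop) fun x => sq_nonneg x, hvar, ENNReal.ofReal_one]
  · rw [hl (fun x => |x / K| ^ α) (by fun_prop) fun x => by positivity]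
    exact ENNReal.ofReal_le_one.mpr hα

end FinMeasure

/-! ### A heavy-tailed null which is a mixture of shifted alternatives -/

/-- The law of a latent pair `(z, y)` of sparse signs, where `y` is sparser when `z = 0`. -/
noncomputable def latentMass (q v : ℝ) (x : Fin 3 × Fin 3) : ℝ :=
  signWeight q x.1 * signWeight (if x.1 = 0 then v / 2 else 1 / 2) x.2

/-- The observation attached to a latent pair of signs. -/
noncomputable def latentValue (a : ℝ) (x : Fin 3 × Fin 3) : ℝ :=
  a * signVal x.1 + √2 * signVal x.2

/-- The mean shift of the component of the mixture labelled by `o`. -/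
noncomputable def latentMean (a : ℝ) (o : Option (Fin 3)) : ℝ := o.elim 0 fun u => a * signVal u

/-- The likelihood ratio with respect to `latentMass` of the law `z = u`, `y ~ signWeight (1/2)`,
or the constant `1` when no `u` is given. -/
noncomputable def latentLR (q v : ℝ) (o : Option (Fin 3)) (x : Fin 3 × Fin 3) : ℝ :=
  o.elim 1 fun u => if x.1 = u then signWeight (1 / 2) x.2 / latentMass q v x else 0

/-- The `L²` inner products of the likelihood ratios `latentLR`. -/
noncomputable def latentCorr (q v : ℝ) : Option (Fin 3) → Option (Fin 3) → ℝ
  | some u, some u' =>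
    if u = u' then (if u = 0 then 1 / ((1 - q) * (v * (2 - v))) else 2 / q) else 0
  | _, _ => 1

section Latent

variable {q v a α K : ℝ}

lemma latentMass_pos (hq0 : 0 < q) (hq1 : q < 1) (hv0 : 0 < v) (hv1 : v ≤ 1)
    (x : Fin 3 × Fin 3) : 0 < latentMass q v x := by
  have h : ∀ q : ℝ, 0 < q → q < 1 → ∀ u, 0 < signWeight q u := by
    intro q hq0 hq1 u
    fin_cases u <;> simp [signWeight] <;> linarith
  refine mul_pos (h q hq0 hq1 _) ?_
  split_ifs
  · exact h _ (by linarith) (by linarith) _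
  · exact h _ (by norm_num) (by norm_num) _

lemma latentLR_nonneg (hq0 : 0 < q) (hq1 : q < 1) (hv0 : 0 < v) (hv1 : v ≤ 1)
    (o : Option (Fin 3)) (x : Fin 3 × Fin 3) : 0 ≤ latentLR q v o x := by
  cases o with
  | none => simp [latentLR]
  | some u =>
    simp only [latentLR, Option.elim_some]
    split_ifs
    · exact div_nonneg (signWeight_nonneg (by norm_num) (by norm_num) _)
        (latentMass_pos hq0 hq1 hv0 hv1 x).le
    · rfl

lemma latentMass_mul_latentLR (hq0 : 0 < q) (hq1 : q < 1) (hv0 : 0 < v) (hv1 : v ≤ 1)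
    (u : Fin 3) (x : Fin 3 × Fin 3) :
    latentMass q v x * latentLR q v (some u) x = if x.1 = u then signWeight (1 / 2) x.2 else 0 := by
  have := (latentMass_pos hq0 hq1 hv0 hv1 x).ne'
  simp only [latentLR, Option.elim_some]
  split_ifs
  · field_simp
  · simp

lemma sum_latentMass : ∑ x, latentMass q v x = 1 := by
  simp [Fintype.sum_prod_type, Fin.sum_univ_three, latentMass, signWeight]
  ring

lemma sum_latentMass_mul_latentLR (hq0 : 0 < q) (hq1 : q < 1) (hv0 : 0 < v) (hv1 : v ≤ 1)
    (o : Option (Fin 3)) : ∑ x, latentMass q v x * latentLR q v o x = 1 := by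
  cases o with
  | none => simpa [latentLR] using sum_latentMass
  | some u =>
    simp only [latentMass_mul_latentLR hq0 hq1 hv0 hv1, Fintype.sum_prod_type]
    rw [Finset.sum_eq_single u (by intro z _ hz; simp [hz]) (by simp)]
    simp [Fin.sum_univ_three, signWeight]
    norm_num

lemma sum_latentMass_mul_latentLR_mul (hq0 : 0 < q) (hq1 : q < 1) (hv0 : 0 < v) (hv1 : v ≤ 1)
    (o o' : Option (Fin 3)) :
    ∑ x, latentMass q v x * (latentLR q v o x * latentLR q v o' x) = latentCorr q v o o' := by
  rcases o with _ | u
  · simpa [latentLR, latentCorr] using sum_latentMass_mul_latentLR hq0 hq1 hv0 hv1 o'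
  rcases o' with _ | u'
  · simpa [latentLR, latentCorr] using sum_latentMass_mul_latentLR hq0 hq1 hv0 hv1 (some u)
  simp only [← mul_assoc, latentMass_mul_latentLR hq0 hq1 hv0 hv1, Fintype.sum_prod_type]
  rw [Finset.sum_eq_single u (by intro z _ hz; simp [hz]) (by simp)]
  by_cases h : u = u'
  · subst h
    have h1 : 1 - q ≠ 0 := by linarith
    have h2 : 2 - v ≠ 0 := by linarith
    have h3 : 1 - v / 2 ≠ 0 := by linarith
    fin_cases u
    · simp [Fin.sum_univ_three, signWeight, latentLR, latentCorr, latentMass]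
      field_simp
      ring
    · simp [Fin.sum_univ_three, signWeight, latentLR, latentCorr, latentMass]
      field_simp
      ring
    · simp [Fin.sum_univ_three, signWeight, latentLR, latentCorr, latentMass]
      field_simp
      ring
  · simp [latentLR, latentCorr, h]

lemma sum_latentMass_mul_latentValue : ∑ x, latentMass q v x * latentValue a x = 0 := by
  simp [Fintype.sum_prod_type, Fin.sum_univ_three, latentMass, latentValue, signWeight, signVal]
  ring

lemma sum_latentMass_mul_latentValue_sq (h : (1 - q) * v + q * (a ^ 2 + 1) = 1) :
    ∑ x, latentMass q v x * latentValue a x ^ 2 = 1 := by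
  have h2 : √2 ^ 2 = (2 : ℝ) := Real.sq_sqrt (by norm_num)
  simp [Fintype.sum_prod_type, Fin.sum_univ_three, latentMass, latentValue, signWeight, signVal]
  ring_nf
  rw [h2]
  linarith

lemma abs_latentValue_div_rpow_le (hα : 2 ≤ α) (hK : 8 ≤ K) (ha : 0 ≤ a) (x : Fin 3 × Fin 3) :
    |latentValue a x / K| ^ α ≤ 1 / 2 + (if x.1 = 0 then 0 else 1) * (a ^ α / 2) := by
  have hK0 : 0 < K := by linarith
  have hα0 : 0 ≤ α := by linarith
  have hs : √2 ≤ 2 := by rw [Real.sqrt_le_left (by norm_num)]; norm_num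
  have hval : ∀ u, |signVal u| ≤ 1 := by
    intro u
    fin_cases u <;> simp [signVal]
  have hsmall : ∀ y : ℝ, 0 ≤ y → y ≤ 1 / 2 → y ^ α ≤ 1 / 2 := by
    intro y hy0 hy
    calc y ^ α ≤ (1 / 2) ^ α := Real.rpow_le_rpow hy0 hy hα0
      _ ≤ (1 / 2) ^ (1 : ℝ) :=
        Real.rpow_le_rpow_of_exponent_ge (by norm_num) (by norm_num) (by linarith)
      _ = 1 / 2 := Real.rpow_one _
  have h2 : |√2 * signVal x.2| ≤ 2 := by
    rw [abs_mul, abs_of_nonneg (Real.sqrt_nonneg 2)]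
    nlinarith [hval x.2, abs_nonneg (signVal x.2), Real.sqrt_nonneg 2]
  have hT : |latentValue a x| ≤ a * |signVal x.1| + 2 := by
    refine (abs_add_le _ _).trans (add_le_add ?_ h2)
    rw [abs_mul, abs_of_nonneg ha]
  have hdiv : ∀ b, |latentValue a x| ≤ 8 * b → |latentValue a x / K| ≤ b := by
    intro b hb
    have hb0 : 0 ≤ b := by linarith [abs_nonneg (latentValue a x)]
    rw [abs_div, abs_of_pos hK0, div_le_iff₀ hK0]
    nlinarith
  by_cases hz : x.1 = 0
  · rw [hz] at hT
    simp only [signVal, Matrix.cons_val_zero, abs_zero, mul_zero, zero_add] at hT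
    have := hsmall _ (abs_nonneg _) (hdiv (1 / 2) (by linarith))
    simpa [hz] using this
  · rw [if_neg hz, one_mul]
    have hT' : |latentValue a x| ≤ a + 2 := by nlinarith [hval x.1]
    rcases le_total a 2 with h | h
    · have := hsmall _ (abs_nonneg _) (hdiv (1 / 2) (by linarith))
      have : 0 ≤ a ^ α := by positivity
      linarith
    · have h1 : |latentValue a x / K| ^ α ≤ (a * (1 / 2)) ^ α :=
        Real.rpow_le_rpow (abs_nonneg _) (hdiv _ (by linarith)) hα0
      rw [Real.mul_rpow ha (by norm_num)] at h1
      have := hsmall (1 / 2) (by norm_num) le_rfl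
      have : 0 ≤ a ^ α := by positivity
      nlinarith

lemma memP_latent (hq0 : 0 < q) (hq1 : q < 1) (hv0 : 0 < v) (hv1 : v ≤ 1) (hα : 2 ≤ α)
    (hK : 8 ≤ K) (ha : 0 ≤ a) (h : (1 - q) * v + q * (a ^ 2 + 1) = 1) (hqa : q * a ^ α ≤ 1) :
    memP α K ((finMeasure (latentMass q v)).map (latentValue a)) := by
  refine memP_finMeasure_map (fun x => (latentMass_pos hq0 hq1 hv0 hv1 x).le) sum_latentMass
    sum_latentMass_mul_latentValue (sum_latentMass_mul_latentValue_sq h) ?_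
  refine (Finset.sum_le_sum fun x _ => mul_le_mul_of_nonneg_left
    (abs_latentValue_div_rpow_le hα hK ha x) (latentMass_pos hq0 hq1 hv0 hv1 x).le).trans ?_
  have : ∑ x, latentMass q v x * (1 / 2 + (if x.1 = 0 then 0 else 1) * (a ^ α / 2)) =
      1 / 2 + q * a ^ α / 2 := by
    simp [Fintype.sum_prod_type, Fin.sum_univ_three, latentMass, signWeight]
    ring
  linarith

lemma memP_latentLR (hq0 : 0 < q) (hq1 : q < 1) (hv0 : 0 < v) (hv1 : v ≤ 1) (hα : 2 ≤ α)
    (hK : 8 ≤ K) (ha : 0 ≤ a) (h : (1 - q) * v + q * (a ^ 2 + 1) = 1) (hqa : q * a ^ α ≤ 1)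
    (o : Option (Fin 3)) :
    memP α K (((finMeasure (latentMass q v)).withDensity fun x =>
      ENNReal.ofReal (latentLR q v o x)).map fun x => latentValue a x - latentMean a o) := by
  have hr := fun x => (latentMass_pos hq0 hq1 hv0 hv1 x).le
  cases o with
  | none => simpa [latentLR, latentMean] using memP_latent hq0 hq1 hv0 hv1 hα hK ha h hqa
  | some u =>
    rw [withDensity_finMeasure hr]
    have hsum : ∀ f : ℝ → ℝ, ∑ x, latentMass q v x * latentLR q v (some u) x *
        f (latentValue a x - latentMean a (some u)) =
        ∑ y, signWeight (1 / 2) y * f (√2 * signVal y) := by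
      intro f
      simp only [latentMass_mul_latentLR hq0 hq1 hv0 hv1, Fintype.sum_prod_type]
      rw [Finset.sum_eq_single u (by intro z _ hz; simp [hz]) (by simp)]
      simp [latentValue, latentMean]
    refine memP_finMeasure_map
      (fun x => mul_nonneg (hr x) (latentLR_nonneg hq0 hq1 hv0 hv1 _ x))
      (sum_latentMass_mul_latentLR hq0 hq1 hv0 hv1 _) ?_ ?_ ?_
    · rw [hsum fun x => x]
      simp [Fin.sum_univ_three, signWeight, signVal]
    · rw [hsum fun x => x ^ 2]
      simp [Fin.sum_univ_three, signWeight, signVal]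
      norm_num
    · rw [hsum fun x => |x / K| ^ α]
      have hle : ∀ y, |√2 * signVal y / K| ^ α ≤ 1 := by
        intro y
        have := abs_latentValue_div_rpow_le hα hK le_rfl ((0 : Fin 3), y)
        simp [latentValue] at this
        linarith
      have h0 := fun y => signWeight_nonneg (q := 1 / 2) (by norm_num) (by norm_num) y
      refine (Finset.sum_le_sum fun y _ => mul_le_mul_of_nonneg_left (hle y) (h0 y)).trans ?_
      simp [Fin.sum_univ_three, signWeight]
      norm_num

end Latent

/-- Parameters for which the latent null law and all its components are admissible noise. -/
lemma exists_latent_variance {q a : ℝ} (hq0 : 0 < q) (hq1 : q ≤ 1 / 2) (hqa : q * a ^ 2 ≤ 1 / 4) :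
    ∃ v, 1 / 2 ≤ v ∧ v ≤ 1 ∧ 1 - v ≤ 2 * (q * a ^ 2) ∧ (1 - q) * v + q * (a ^ 2 + 1) = 1 := by
  have h1 : 0 < 1 - q := by linarith
  have h2 : q * a ^ 2 / (1 - q) ≤ 2 * (q * a ^ 2) := by
    rw [div_le_iff₀ h1]
    nlinarith [mul_nonneg hq0.le (sq_nonneg a)]
  have h3 : 0 ≤ q * a ^ 2 / (1 - q) := by positivity
  refine ⟨1 - q * a ^ 2 / (1 - q), by linarith, by linarith, by linarith, ?_⟩
  field_simp
  ring

lemma half_le_risk_latent {p n s : ℕ} {α K ρ q v a : ℝ} {φ : (Fin n → Fin p → ℝ) → ℝ}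
    {ι : Type*} [Fintype ι] (hφ : IsTest p n φ) (hn : 2 ≤ n)
    (hq0 : 0 < q) (hq1 : q < 1) (hv0 : 0 < v) (hv1 : v ≤ 1) (hα : 2 ≤ α)
    (hK : 8 ≤ K) (ha : 0 ≤ a) (h : (1 - q) * v + q * (a ^ 2 + 1) = 1) (hqa : q * a ^ α ≤ 1)
    (w : ι → ℝ) (hw : ∀ i, 0 ≤ w i) (hw1 : ∑ i, w i = 1) (o : ι → Fin p → Option (Fin 3))
    (hsecond : ∑ i, ∑ i', w i * w i' * ∏ j, latentCorr q v (o i j) (o i' j) ≤ 9 / 8)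
    (G : Finset ι) (hG : ∑ i ∈ Gᶜ, w i ≤ 1 / 8)
    (hs : ∀ i ∈ G, l0 p (fun j => latentMean a (o i j)) ≤ s)
    (hρ : ∀ i ∈ G, ρ ^ 2 ≤ sqnorm p (fun j => latentMean a (o i j)) / 2) :
    1 / 2 ≤ risk p n (Pclass p n α K) (Theta1 p n s ρ) φ := by
  have hr := fun x => (latentMass_pos hq0 hq1 hv0 hv1 x).le
  have hprob := isProbabilityMeasure_finMeasure hr sum_latentMass
  set O : ι → Fin n → Fin p → Option (Fin 3) :=
    fun i t j => if (t : ℕ) < 1 then o i j else none with hO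
  have hθ : ∀ i, (fun t j => latentMean a (O i t j)) =
      fun (t : Fin n) j => if (t : ℕ) < 1 then latentMean a (o i j) else 0 := by
    intro i
    funext t j
    simp only [hO]
    split_ifs <;> simp [latentMean]
  refine half_le_risk_of_second_moment hφ (finMeasure (latentMass q v)) (latentValue a)
    (measurable_of_finite _) (memP_latent hq0 hq1 hv0 hv1 hα hK ha h hqa) w hw hw1
    (fun i t j => latentMean a (O i t j)) (fun i t j => latentLR q v (O i t j))
    (fun i t j => measurable_of_finite _) (fun i t j => latentLR_nonneg hq0 hq1 hv0 hv1 _)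
    (fun i t j => Integrable.of_finite) (fun i t j => ?_)
    (fun i i' t j => Integrable.of_finite) ?_ G hG (fun i hi => ?_)
    (fun i _ t j => memP_latentLR hq0 hq1 hv0 hv1 hα hK ha h hqa _)
  · rw [integral_finMeasure hr]
    exact sum_latentMass_mul_latentLR hq0 hq1 hv0 hv1 _
  · refine le_trans (le_of_eq ?_) hsecond
    refine Finset.sum_congr rfl fun i _ => Finset.sum_congr rfl fun i' _ => ?_
    congr 1
    simp only [integral_finMeasure hr, sum_latentMass_mul_latentLR_mul hq0 hq1 hv0 hv1]
    rw [Finset.prod_eq_single (⟨0, by omega⟩ : Fin n)]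
    · simp [hO]
    · intro t _ ht
      have : (t : ℕ) ≠ 0 := fun h' => ht (Fin.ext h')
      simp [hO, this, latentCorr]
    · simp
  · rw [hθ]
    refine early_change_mem_Theta1 le_rfl (by omega) _ (hs i hi) ?_
    have := hρ i hi
    push_cast
    linarith

/-! ### Lower bounds with heavy-tailed noise -/

lemma rpow_one_div_div_eight {α r q : ℝ} (hα : 2 ≤ α) (hr : 1 ≤ r) (hq : 0 ≤ q)
    (hqr : q * r ≤ 16) :
    (r ^ (1 / α) / 8) ^ 2 = r ^ (2 / α) / 64 ∧ q * (r ^ (1 / α) / 8) ^ 2 ≤ 1 / 4 ∧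
      q * (r ^ (1 / α) / 8) ^ α ≤ 1 := by
  have hα0 : 0 < α := by linarith
  have hr0 : 0 ≤ r := by linarith
  have haa : (r ^ (1 / α) / 8) ^ 2 = r ^ (2 / α) / 64 := by
    rw [div_pow, ← Real.rpow_natCast, ← Real.rpow_mul hr0]
    norm_num
    congr 1
    ring
  refine ⟨haa, ?_, ?_⟩
  · have : r ^ (2 / α) ≤ r := by
      simpa using Real.rpow_le_rpow_of_exponent_le hr ((div_le_one hα0).mpr hα)
    rw [haa]
    nlinarith
  · have h8 : (8 : ℝ) ^ 2 ≤ 8 ^ α := by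
      rw [← Real.rpow_natCast]
      exact Real.rpow_le_rpow_of_exponent_le (by norm_num) (by exact_mod_cast hα)
    rw [Real.div_rpow (by positivity) (by norm_num), ← Real.rpow_mul hr0,
      one_div_mul_cancel hα0.ne', Real.rpow_one, ← mul_div_assoc, div_le_one (by positivity)]
    linarith

lemma half_le_risk_of_sq_le_rpow {p n s : ℕ} {α K ρ : ℝ} {φ : (Fin n → Fin p → ℝ) → ℝ}
    (hφ : IsTest p n φ) (hn : 2 ≤ n) (hα : 2 ≤ α) (hK : 8 ≤ K) (hp : 32 ≤ p) (hs : 1 ≤ s)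
    (hρ : ρ ^ 2 ≤ (p : ℝ) ^ (2 / α) / 128) :
    1 / 2 ≤ risk p n (Pclass p n α K) (Theta1 p n s ρ) φ := by
  have hp' : (32 : ℝ) ≤ p := by exact_mod_cast hp
  have hp0 : (0 : ℝ) < p := by linarith
  set a : ℝ := (p : ℝ) ^ (1 / α) / 8 with ha
  set q : ℝ := 16 / p with hq
  have hpq : p * q = 16 := by rw [hq]; field_simp
  have hq0 : 0 < q := by positivity
  have hq1 : q ≤ 1 / 2 := by rw [hq, div_le_iff₀ hp0]; linarith
  have ha0 : 0 ≤ a := by positivity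
  obtain ⟨haa, hqaa, hqα⟩ := rpow_one_div_div_eight hα (by linarith : (1 : ℝ) ≤ p) hq0.le
    (by linarith : q * p ≤ 16)
  obtain ⟨v, hv0, hv1, -, hv⟩ := exists_latent_variance hq0 hq1 hqaa
  have hmean : ∀ i j : Fin p, latentMean a (if j = i then some 1 else none) =
      if j = i then a else 0 := by
    intro i j
    split_ifs <;> simp [latentMean, signVal]
  refine half_le_risk_latent hφ hn hq0 (by linarith) (by linarith) hv1 hα hK ha0 hv hqα
    (fun _ : Fin p => 1 / (p : ℝ)) (fun _ => by positivity)
    (by simp [hp0.ne']) (fun i j => if j = i then some 1 else none) ?_ Finset.univ (by simp)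
    (fun i _ => ?_) (fun i _ => ?_)
  · have hprod : ∀ i i' : Fin p, ∏ j, latentCorr q v (if j = i then some 1 else none)
        (if j = i' then some 1 else none) = if i = i' then 2 / q else 1 := by
      intro i i'
      rw [Finset.prod_eq_single i]
      · by_cases h : i = i' <;> simp [h, latentCorr]
      · intro j _ hj
        simp [hj, latentCorr]
      · simp
    have hle : ∀ i i' : Fin p, (1 / (p : ℝ) * (1 / p) * if i = i' then 2 / q else 1) ≤
        1 / (p : ℝ) * (1 / p) * (1 + if i = i' then 2 / q else 0) := by
      intro i i'
      refine mul_le_mul_of_nonneg_left ?_ (by positivity)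
      split_ifs <;> linarith
    simp only [hprod]
    refine (Finset.sum_le_sum fun i _ => Finset.sum_le_sum fun i' _ => hle i i').trans ?_
    simp only [← Finset.mul_sum, Finset.sum_add_distrib]
    simp only [Finset.sum_ite_eq, Finset.mem_univ, if_true, Finset.sum_const, Finset.card_univ,
      Fintype.card_fin, nsmul_eq_mul, mul_one]
    rw [hq]
    field_simp
    norm_num
  · refine le_trans ?_ hs
    refine (Finset.card_le_card fun j => ?_).trans (Finset.card_singleton i).le
    simp only [Finset.mem_filter, Finset.mem_univ, true_and, Finset.mem_singleton, hmean]
    intro h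
    by_contra h0
    simp [h0] at h
  · simp only [hmean, sqnorm]
    rw [Finset.sum_eq_single i (by intro j _ hj; simp [hj]) (by simp), if_pos rfl, haa]
    linarith

lemma sum_signWeight_latentCorr_le {q v : ℝ} (hq0 : 0 < q) (hq1 : q ≤ 1 / 2) (hv0 : 1 / 2 ≤ v)
    (hv1 : v ≤ 1) :
    ∑ u, ∑ u', signWeight q u * signWeight q u' * latentCorr q v (some u) (some u') ≤
      1 + 2 * (1 - v) ^ 2 := by
  have h1 : 1 - q ≠ 0 := by linarith
  have h : ∑ u, ∑ u', signWeight q u * signWeight q u' * latentCorr q v (some u) (some u') =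
      (1 - q) * (1 / (v * (2 - v))) + q := by
    simp [Fin.sum_univ_three, signWeight, latentCorr]
    field_simp
    ring
  have h2 : 1 / (v * (2 - v)) ≤ 1 + 2 * (1 - v) ^ 2 := by
    have h3 : 0 ≤ 1 - v := by linarith
    have h4 : (1 - v) ^ 2 ≤ 1 / 4 := by nlinarith
    rw [div_le_iff₀ (by nlinarith)]
    nlinarith [sq_nonneg (1 - v)]
  rw [h]
  nlinarith [mul_le_mul_of_nonneg_left h2 (by linarith : 0 ≤ 1 - q), sq_nonneg (1 - v)]

lemma sum_sign_prior_latentCorr_le {p : ℕ} {q v y : ℝ} (hq0 : 0 < q) (hq1 : q ≤ 1 / 2)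
    (hv0 : 1 / 2 ≤ v) (hv1 : v ≤ 1) (hvy : 1 - v ≤ 2 * y) (hpy : p * (8 * y ^ 2) ≤ 1 / 9) :
    ∑ σ : Fin p → Fin 3, ∑ σ' : Fin p → Fin 3,
      (∏ j, signWeight q (σ j)) * (∏ j, signWeight q (σ' j)) *
        ∏ j, latentCorr q v (some (σ j)) (some (σ' j)) ≤ 9 / 8 := by
  simp only [← Finset.prod_mul_distrib]
  rw [sum_sum_prod_eq_pow fun u u' => signWeight q u * signWeight q u' *
    latentCorr q v (some u) (some u')]
  have hnn : 0 ≤ ∑ u, ∑ u', signWeight q u * signWeight q u' *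
      latentCorr q v (some u) (some u') := by
    have hw := fun u => signWeight_nonneg hq0.le (by linarith : q ≤ 1) u
    refine Finset.sum_nonneg fun u _ => Finset.sum_nonneg fun u' _ =>
      mul_nonneg (mul_nonneg (hw u) (hw u')) ?_
    have h1 : 0 ≤ 1 - q := by linarith
    have h2 : 0 ≤ 2 - v := by linarith
    simp only [latentCorr]
    split_ifs <;> positivity
  have hle : ∑ u, ∑ u', signWeight q u * signWeight q u' *
      latentCorr q v (some u) (some u') ≤ Real.exp (8 * y ^ 2) := by
    refine (sum_signWeight_latentCorr_le hq0 hq1 hv0 hv1).trans ?_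
    have := pow_le_pow_left₀ (by linarith) hvy 2
    linarith [Real.add_one_le_exp (8 * y ^ 2)]
  refine (pow_le_pow_left₀ hnn hle p).trans ?_
  rw [← Real.exp_nat_mul]
  refine (Real.exp_le_exp.mpr hpy).trans ?_
  have h := Real.add_one_le_exp (-(1 / 9 : ℝ))
  rw [Real.exp_neg] at h
  have h0 := Real.exp_pos (1 / 9 : ℝ)
  have := mul_le_mul_of_nonneg_right h h0.le
  rw [inv_mul_cancel₀ h0.ne'] at this
  linarith

lemma half_le_risk_of_sq_le_sparse {p n s : ℕ} {α K ρ m : ℝ} {φ : (Fin n → Fin p → ℝ) → ℝ}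
    (hφ : IsTest p n φ) (hn : 2 ≤ n) (hα : 2 ≤ α) (hK : 8 ≤ K) (hm : 1024 ≤ m) (hms : m ≤ s)
    (hsp : s ≤ p) (hmp : m * (p / m) ^ (2 / α) ≤ √p)
    (hρ : ρ ^ 2 ≤ m * (p / m) ^ (2 / α) / 2048) :
    1 / 2 ≤ risk p n (Pclass p n α K) (Theta1 p n s ρ) φ := by
  have hsp' : (s : ℝ) ≤ p := by exact_mod_cast hsp
  have hm0 : 0 < m := by linarith
  have hp0 : (0 : ℝ) < p := by linarith
  have hr1 : 1 ≤ (p : ℝ) / m := by rw [le_div_iff₀ hm0]; linarith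
  set a : ℝ := ((p : ℝ) / m) ^ (1 / α) / 8 with ha
  set q : ℝ := m / (4 * p) with hq
  have hpq : p * q = m / 4 := by rw [hq]; field_simp
  have hq0 : 0 < q := by positivity
  have hq1 : q ≤ 1 / 2 := by rw [hq, div_le_iff₀ (by positivity)]; linarith
  have ha0 : 0 ≤ a := by positivity
  have hqr : q * (p / m) ≤ 16 := by
    rw [hq]
    field_simp
    norm_num
  obtain ⟨haa, hqaa, hqα⟩ := rpow_one_div_div_eight hα hr1 hq0.le hqr
  rw [← ha] at haa hqaa hqα
  have hma : m * a ^ 2 ≤ √p / 64 := by rw [haa]; linarith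
  have hpqa : p * (8 * (q * a ^ 2) ^ 2) ≤ 1 / 9 := by
    have h1 : p * (q * a ^ 2) = m * a ^ 2 / 4 := by rw [← mul_assoc, hpq]; ring
    have h2 : (m * a ^ 2) ^ 2 ≤ p / 64 ^ 2 := by
      have := pow_le_pow_left₀ (by positivity) hma 2
      rwa [div_pow (√p), Real.sq_sqrt hp0.le] at this
    have h3 : p * (p * (8 * (q * a ^ 2) ^ 2)) ≤ p * (1 / 9) := by
      have : p * (p * (8 * (q * a ^ 2) ^ 2)) = 8 * (p * (q * a ^ 2)) ^ 2 := by ring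
      rw [this, h1, div_pow]
      linarith
    exact le_of_mul_le_mul_left h3 hp0
  clear_value a q
  obtain ⟨v, hv0, hv1, hvq, hv⟩ := exists_latent_variance hq0 hq1 hqaa
  have hGw := sum_atypical_le p hq0.le (by linarith) hm hpq
  have hmean : ∀ u, latentMean a (some u) = a * signVal u := fun u => rfl
  refine half_le_risk_latent hφ hn hq0 (by linarith) (by linarith) hv1 hα hK ha0 hv hqα
    (fun σ : Fin p → Fin 3 => ∏ j, signWeight q (σ j))
    (fun σ => Finset.prod_nonneg fun j _ => signWeight_nonneg hq0.le (by linarith) _)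
    (sum_prod_signWeight p q) (fun σ j => some (σ j)) ?_
    (Finset.univ.filter fun σ : Fin p → Fin 3 =>
      m / 16 ≤ supportSize σ ∧ (supportSize σ : ℝ) ≤ m) (by convert hGw)
    (fun σ hσ => ?_) (fun σ hσ => ?_)
  · exact sum_sign_prior_latentCorr_le hq0 hq1 hv0 hv1 hvq hpqa
  · have hσ' := (Finset.mem_filter.mp hσ).2
    simp only [hmean]
    refine (l0_mul_signVal_le _ _).trans ?_
    exact_mod_cast hσ'.2.trans hms
  · have hσ' := (Finset.mem_filter.mp hσ).2
    simp only [hmean, sqnorm_mul_signVal]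
    have h1 := mul_le_mul_of_nonneg_left hσ'.1 (sq_nonneg a)
    have h2 : m * (p / m) ^ (2 / α) = 64 * (m * a ^ 2) := by rw [haa]; ring
    rw [h2] at hρ
    linarith

/-! ### Combining the lower bounds -/

lemma mul_div_rpow_eq {x y e : ℝ} (hx : 0 < x) (hy : 0 < y) :
    x * (y / x) ^ e = x ^ (1 - e) * y ^ e := by
  rw [Real.div_rpow hy.le hx.le, Real.rpow_sub hx, Real.rpow_one]
  ring

lemma half_le_risk_of_sq_le_min {p n s : ℕ} {α K ρ : ℝ} {φ : (Fin n → Fin p → ℝ) → ℝ}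
    (hφ : IsTest p n φ) (hn : 2 ≤ n) (hα : 4 ≤ α) (hK : 8 ≤ K) (hs : 1024 ≤ s) (hsp : s ≤ p)
    (hρ : ρ ^ 2 ≤ min (s * ((p : ℝ) / s) ^ (2 / α)) √p / 131072) :
    1 / 2 ≤ risk p n (Pclass p n α K) (Theta1 p n s ρ) φ := by
  have hs' : (1024 : ℝ) ≤ s := by exact_mod_cast hs
  have hsp' : (s : ℝ) ≤ p := by exact_mod_cast hsp
  have hs0 : (0 : ℝ) < s := by linarith
  have hp0 : (0 : ℝ) < p := by linarith
  have hp1 : (1 : ℝ) ≤ p := by linarith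
  have hα2 : 2 ≤ α := by linarith
  have hα0 : 0 < α := by linarith
  have h0 : 0 ≤ ρ ^ 2 := sq_nonneg ρ
  rcases le_or_gt (s * ((p : ℝ) / s) ^ (2 / α)) √p with h | h
  · rw [min_eq_left h] at hρ
    exact half_le_risk_of_sq_le_sparse hφ hn hα2 hK hs' le_rfl hsp h (by linarith)
  rw [min_eq_right h.le] at hρ
  set m : ℝ := (p : ℝ) ^ ((α - 4) / (2 * (α - 2))) with hm
  have hm1 : 1 ≤ m := Real.one_le_rpow hp1 (div_nonneg (by linarith) (by linarith))
  have hm0 : 0 < m := by linarith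
  have hmp : m * (p / m) ^ (2 / α) = √p := by
    rw [mul_div_rpow_eq hm0 hp0, hm, ← Real.rpow_mul hp0.le, ← Real.rpow_add hp0,
      Real.sqrt_eq_rpow]
    congr 1
    have : α - 2 ≠ 0 := by linarith
    field_simp
    ring
  rcases le_or_gt 1024 m with hm2 | hm2
  · have hms : m ≤ s := by
      by_contra! hlt
      have he : 0 ≤ 1 - 2 / α := by
        rw [sub_nonneg, div_le_one hα0]
        exact hα2
      have := mul_le_mul_of_nonneg_right (Real.rpow_le_rpow hs0.le hlt.le he)
        (by positivity : 0 ≤ (p : ℝ) ^ (2 / α))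
      rw [← mul_div_rpow_eq hs0 hp0, ← mul_div_rpow_eq hm0 hp0, hmp] at this
      linarith
    exact half_le_risk_of_sq_le_sparse hφ hn hα2 hK hm2 hms hsp hmp.le (by rw [hmp]; linarith)
  · refine half_le_risk_of_sq_le_rpow hφ hn hα2 hK (by omega) (by omega) ?_
    have h1 : ((p : ℝ) / m) ^ (2 / α) ≤ (p : ℝ) ^ (2 / α) :=
      Real.rpow_le_rpow (by positivity) (div_le_self hp0.le hm1) (by positivity)
    have h2 : 0 ≤ (p : ℝ) ^ (2 / α) := by positivity
    have h3 : √p ≤ 1024 * (p : ℝ) ^ (2 / α) := by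
      rw [← hmp]
      exact mul_le_mul hm2.le h1 (by positivity) (by norm_num)
    linarith

/-- Theorem: minimax lower bound under finite-moment noise. -/
theorem statement_6 :
    ∃ c : ℝ, 1 ≤ c ∧
      ∀ α : ℝ, 2 ≤ α →
        ∃ Kα : ℝ, 0 < Kα ∧
          ∀ K : ℝ, Kα ≤ K →
            ∃ c' : ℝ, 0 < c' ∧
              ∀ p n s : ℕ, 0 < p → 2 ≤ n → c ≤ (s : ℝ) → s ≤ p →
                ∀ ρ : ℝ,
                  ρ ^ 2 ≤ c' *
                      (min ((s : ℝ) * ((p : ℝ) / (s : ℝ)) ^ ((2 : ℝ) / α))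
                        ((p : ℝ) ^ max ((2 : ℝ) / α) ((1 : ℝ) / 2) *
                          (if Real.sqrt ((p : ℝ) * LL n) < (s : ℝ) ∧ 4 ≤ α
                           then Real.sqrt (LL n) else 1)) +
                      LL n) →
                  ∀ φ : (Fin n → Fin p → ℝ) → ℝ, IsTest p n φ →
                    1 / 2 ≤ risk p n (Pclass p n α K) (Theta1 p n s ρ) φ := by
  refine ⟨1024, by norm_num, fun α hα => ?_⟩
  obtain ⟨K₀, -, hK₀⟩ := exists_memP_gaussianReal hα
  refine ⟨max 8 K₀, by positivity, fun K hK => ⟨1 / 262144, by norm_num, ?_⟩⟩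
  intro p n s hp hn hs hsp ρ hρ φ hφ
  have hK8 : 8 ≤ K := (le_max_left _ _).trans hK
  have hmem := hK₀ K ((le_max_right _ _).trans hK)
  have hs' : 1024 ≤ s := by exact_mod_cast hs
  have hp0 : (0 : ℝ) < p := by exact_mod_cast hp
  have hα0 : 0 < α := by linarith
  have hL := LL_pos hn
  rcases le_or_gt (min ((s : ℝ) * ((p : ℝ) / (s : ℝ)) ^ ((2 : ℝ) / α))
      ((p : ℝ) ^ max ((2 : ℝ) / α) ((1 : ℝ) / 2) *
        (if Real.sqrt ((p : ℝ) * LL n) < (s : ℝ) ∧ 4 ≤ α then Real.sqrt (LL n) else 1)))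
      (LL n) with h | h
  · exact half_le_risk_of_sq_le_LL hφ hmem hn hp (by omega) (by linarith)
  have hle := min_le_right ((s : ℝ) * ((p : ℝ) / (s : ℝ)) ^ ((2 : ℝ) / α))
    ((p : ℝ) ^ max ((2 : ℝ) / α) ((1 : ℝ) / 2) *
      (if Real.sqrt ((p : ℝ) * LL n) < (s : ℝ) ∧ 4 ≤ α then Real.sqrt (LL n) else 1))
  rcases lt_or_ge α 4 with hα4 | hα4
  · rw [if_neg (by rintro ⟨-, h4⟩; linarith), mul_one] at hρ h hle
    rw [max_eq_left (by rw [div_le_div_iff₀ two_pos hα0]; linarith)] at hρ h hle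
    have h0 : 0 ≤ (p : ℝ) ^ ((2 : ℝ) / α) := by positivity
    exact half_le_risk_of_sq_le_rpow hφ hn hα hK8 (by omega) (by omega) (by linarith)
  · rw [max_eq_right (by rw [div_le_div_iff₀ hα0 two_pos]; linarith), ← Real.sqrt_eq_rpow]
      at hρ h hle
    by_cases hsL : √(p * LL n) < s
    · rw [if_pos ⟨hsL, hα4⟩, ← Real.sqrt_mul hp0.le] at hρ h hle
      have h0 : 0 ≤ √(p * LL n) := Real.sqrt_nonneg _
      exact half_le_risk_of_sq_le_sqrt hφ hmem hn hs' hsp hsL (by linarith)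
    · rw [if_neg (fun h' => hsL h'.1), mul_one] at hρ h
      exact half_le_risk_of_sq_le_min hφ hn hα4 hK8 hs' hsp (by linarith)

end ChangePoint
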